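/- Let f be a C^{1+bv} diffeomorphism of [0,1]. Then V_∞(f) = 0 if and only if f embeds into a C^1 flow on [0,1] and f has no hyperbolic fixed point (i.e. Df(p) = 1 at every fixed point p of f). -/

import Mathlib

open Set MeasureTheory Filter Topology

noncomputable section

/-- An orientation-preserving `C¹` diffeomorphism of the interval `[0,1]`, recorded together
with its derivative, and extended by the identity outside of `[0,1]`. -/
structure C1Diffeo : Type where
  toFun : ℝ → ℝ
  derivFun : ℝ → ℝ
  map_zero : toFun 0 = 0
  map_one : toFun 1 = 1
  fixes_outside : ∀ x : ℝ, x ∉ Icc (0:ℝ) 1 → toFun x = x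
  bijOn : BijOn toFun (Icc (0:ℝ) 1) (Icc (0:ℝ) 1)
  hasDeriv : ∀ x ∈ Icc (0:ℝ) 1, HasDerivWithinAt toFun (derivFun x) (Icc (0:ℝ) 1) x
  derivFun_cont : ContinuousOn derivFun (Icc (0:ℝ) 1)
  derivFun_pos : ∀ x ∈ Icc (0:ℝ) 1, 0 < derivFun x

/-- A `C^{1+bv}` diffeomorphism of `[0,1]`: a `C¹` diffeomorphism such that `log Df` has
finite total variation. -/
structure C1bvDiffeo extends C1Diffeo where
  logDeriv_bv : BoundedVariationOn (fun x => Real.log (derivFun x)) (Icc (0:ℝ) 1)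

/-- An action of `ℤᵈ` on `[0,1]` by orientation-preserving `C^{1+bv}` diffeomorphisms. -/
structure ZdAction1bv (d : ℕ) where
  elt : (Fin d → ℤ) → C1bvDiffeo
  elt_add : ∀ a b : Fin d → ℤ, ∀ x : ℝ,
    (elt (a + b)).toFun x = (elt a).toFun ((elt b).toFun x)
  elt_zero : ∀ x : ℝ, (elt 0).toFun x = x

/-- `Φ`, together with its spatial derivative `Φ'`, is a `C¹` flow on the one-dimensional
manifold-with-boundary `s ⊆ ℝ` (extended by the identity outside of `s`): a continuous group
homomorphism from `(ℝ,+)` to the orientation-preserving `C¹` diffeomorphisms of `s` endowed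
with the `C¹` topology. -/
def IsC1FlowOn (s : Set ℝ) (Φ Φ' : ℝ → ℝ → ℝ) : Prop :=
  (∀ x : ℝ, Φ 0 x = x) ∧
  (∀ t u : ℝ, ∀ x : ℝ, Φ (t + u) x = Φ t (Φ u x)) ∧
  (∀ t : ℝ, ∀ x ∉ s, Φ t x = x) ∧
  (∀ t : ℝ, BijOn (Φ t) s s) ∧
  (∀ t : ℝ, ∀ x ∈ s, HasDerivWithinAt (Φ t) (Φ' t x) s x) ∧
  (∀ t : ℝ, ContinuousOn (Φ' t) s) ∧
  (∀ t : ℝ, ∀ x ∈ s, 0 < Φ' t x) ∧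
  (∀ t₀ : ℝ, ∀ K : Set ℝ, IsCompact K → K ⊆ s → ∀ ε > (0:ℝ), ∃ δ > (0:ℝ), ∀ t : ℝ,
    |t - t₀| < δ → ∀ x ∈ K,
      |Φ t x - Φ t₀ x| + |Real.log (Φ' t x) - Real.log (Φ' t₀ x)| < ε)

/-- `log D(fⁿ)`, computed via the chain rule: `log D(fⁿ)(x) = ∑_{k<n} log Df(fᵏ(x))`. -/
def logDIter (f : C1bvDiffeo) (n : ℕ) (x : ℝ) : ℝ :=
  ∑ k ∈ Finset.range n, Real.log (f.derivFun (f.toFun^[k] x))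

/-- `var (log D(fⁿ))` over `[0,1]`. -/
def varLogDIter (f : C1bvDiffeo) (n : ℕ) : ℝ :=
  (eVariationOn (logDIter f n) (Icc (0:ℝ) 1)).toReal


/-- abstract setting: a C¹ diffeo of the line with log-derivative controlled by a monotone `W` -/
structure Su where
  f : ℝ ≃o ℝ
  L : ℝ → ℝ
  W : ℝ → ℝ
  hd : ∀ x, HasDerivAt f (Real.exp (L x)) x
  Lc : Continuous L
  Wc : Continuous W
  Wm : Monotone W
  LW : ∀ x y, x ≤ y → |L y - L x| ≤ W y - W x
  Lfix : ∀ x, f x = x → L x = 0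

namespace Su
variable (S : Su)

def it (k : ℤ) (x : ℝ) : ℝ := (S.f ^ k) x

@[simp] lemma it_zero (x : ℝ) : S.it 0 x = x := by simp [it]
lemma it_add (j k : ℤ) (x : ℝ) : S.it (j + k) x = S.it j (S.it k x) := by
  simp [it, zpow_add, RelIso.mul_apply]
@[simp] lemma it_one (x : ℝ) : S.it 1 x = S.f x := by simp [it]
lemma it_succ (k : ℤ) (x : ℝ) : S.it (k + 1) x = S.f (S.it k x) := by
  rw [add_comm, it_add, it_one]
lemma it_succ' (k : ℤ) (x : ℝ) : S.it (k + 1) x = S.it k (S.f x) := by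
  rw [it_add, it_one]
lemma it_mono (k : ℤ) : StrictMono (S.it k) := (S.f ^ k).strictMono
lemma it_cont (k : ℤ) : Continuous (S.it k) := (S.f ^ k).continuous
lemma it_neg_it (k : ℤ) (x : ℝ) : S.it (-k) (S.it k x) = x := by
  rw [← it_add]; simp
lemma it_it_neg (k : ℤ) (x : ℝ) : S.it k (S.it (-k) x) = x := by
  rw [← it_add]; simp
lemma it_fix {p : ℝ} (hp : S.f p = p) (k : ℤ) : S.it k p = p := by
  induction k using Int.induction_on with
  | zero => simp
  | succ n ih => rw [it_succ, ih, hp]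
  | pred n ih =>
    have := S.it_succ' (-(n:ℤ) - 1) p
    rw [hp] at this
    rw [← this]; simpa using ih
lemma iterate_eq (n : ℕ) (x : ℝ) : (S.f)^[n] x = S.it n x := by
  induction n with
  | zero => simp
  | succ n ih => rw [Function.iterate_succ_apply', ih]; push_cast; rw [it_succ]

def g (n : ℕ) (x : ℝ) : ℝ := ∑ j ∈ Finset.range n, S.L (S.it j x)

/-- consecutive fixed points -/
structure Cmp (a b : ℝ) : Prop where
  ab : a < b
  fa : S.f a = a
  fb : S.f b = b
  ne : ∀ x ∈ Ioo a b, S.f x ≠ x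

structure Inc (a b : ℝ) : Prop extends S.Cmp a b where
  lt : ∀ x ∈ Ioo a b, x < S.f x

variable {S}
lemma Cmp.it_mem {a b : ℝ} (h : S.Cmp a b) (k : ℤ) {x : ℝ} (hx : x ∈ Ioo a b) :
    S.it k x ∈ Ioo a b := by
  constructor
  · simpa [S.it_fix h.fa] using S.it_mono k hx.1
  · simpa [S.it_fix h.fb] using S.it_mono k hx.2

lemma Inc.strictMono {a b : ℝ} (h : S.Inc a b) {x : ℝ} (hx : x ∈ Ioo a b) :
    StrictMono (fun k : ℤ => S.it k x) := by
  apply strictMono_int_of_lt_succ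
  intro k
  rw [it_succ]
  exact h.lt _ (h.toCmp.it_mem k hx)

lemma Cmp.fix_of_mem {a b : ℝ} (h : S.Cmp a b) {l : ℝ} (hl : l ∈ Icc a b) (hf : S.f l = l) :
    l = a ∨ l = b := by
  by_contra hc
  push Not at hc
  exact h.ne l ⟨lt_of_le_of_ne hl.1 (Ne.symm hc.1), lt_of_le_of_ne hl.2 hc.2⟩ hf

lemma Inc.tendsto_fwd {a b : ℝ} (h : S.Inc a b) {x : ℝ} (hx : x ∈ Ioo a b) :
    Tendsto (fun n : ℕ => S.it n x) atTop (𝓝 b) := by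
  have hm : Monotone (fun n : ℕ => S.it n x) := fun i j hij =>
    (h.strictMono hx).monotone (by exact_mod_cast hij)
  have hb : BddAbove (range fun n : ℕ => S.it n x) := ⟨b, by
    rintro _ ⟨n, rfl⟩; exact (h.toCmp.it_mem n hx).2.le⟩
  have ht := tendsto_atTop_ciSup hm hb
  set l := ⨆ n : ℕ, S.it n x
  have hl : S.f l = l := by
    have h1 := (S.f.continuous.tendsto l).comp ht
    have h2 := (tendsto_add_atTop_iff_nat 1).2 ht
    refine tendsto_nhds_unique h1 (h2.congr fun n => ?_)
    push_cast
    rw [it_succ]; rfl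
  have hxl : x ≤ l := by simpa using le_ciSup hb 0
  have hlb : l ≤ b := ciSup_le fun n => (h.toCmp.it_mem n hx).2.le
  rcases h.toCmp.fix_of_mem ⟨hx.1.le.trans hxl, hlb⟩ hl with h0 | h0
  · exact absurd (hx.1.trans_le hxl) (by rw [h0]; exact lt_irrefl _)
  · rwa [← h0]

lemma Inc.tendsto_bwd {a b : ℝ} (h : S.Inc a b) {x : ℝ} (hx : x ∈ Ioo a b) :
    Tendsto (fun n : ℕ => S.it (-n) x) atTop (𝓝 a) := by
  have hm : Antitone (fun n : ℕ => S.it (-n) x) := fun i j hij =>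
    (h.strictMono hx).monotone (by simpa using hij)
  have hb : BddBelow (range fun n : ℕ => S.it (-n) x) := ⟨a, by
    rintro _ ⟨n, rfl⟩; exact (h.toCmp.it_mem _ hx).1.le⟩
  have ht := tendsto_atTop_ciInf hm hb
  set l := ⨅ n : ℕ, S.it (-n) x
  have hl : S.f l = l := by
    have h2 := (S.f.continuous.tendsto l).comp ((tendsto_add_atTop_iff_nat 1).2 ht)
    refine tendsto_nhds_unique h2 (ht.congr fun n => ?_)
    simp only [Function.comp]
    rw [← it_succ]; push_cast; congr 1; ring
  have hxl : l ≤ x := by simpa using ciInf_le hb 0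
  have hlb : a ≤ l := le_ciInf fun n => (h.toCmp.it_mem _ hx).1.le
  rcases h.toCmp.fix_of_mem ⟨hlb, hxl.trans hx.2.le⟩ hl with h0 | h0
  · rwa [← h0]
  · exact absurd (hx.2.trans_le' hxl) (by rw [h0]; exact lt_irrefl _)

lemma summable_shift {B : ℕ → ℝ} (hB : Monotone B) {C : ℝ} (hC : ∀ n, B n ≤ C) (m : ℕ) :
    Summable (fun j => B (j + m) - B j) := by
  have h1 : Summable (fun j => B (j + 1) - B j) := by
    refine summable_of_sum_range_le (c := C - B 0) (fun n => sub_nonneg.2 (hB (by omega))) ?_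
    intro n
    rw [Finset.sum_range_sub]
    linarith [hC n]
  induction m with
  | zero => simp
  | succ m ih =>
    have h2 := (summable_nat_add_iff m).2 h1
    refine (h2.add ih).congr fun j => ?_
    rw [show j + m + 1 = j + (m + 1) by ring]; ring

lemma abs_L_le (S : Su) (x y : ℝ) : |S.L y - S.L x| ≤ |S.W y - S.W x| := by
  rcases le_total x y with h | h
  · exact (S.LW x y h).trans (le_abs_self _)
  · rw [abs_sub_comm, abs_sub_comm (S.W y)]; exact (S.LW y x h).trans (le_abs_self _)

lemma abs_W_le (S : Su) {u v x y : ℝ} (hx : x ∈ Icc u v) (hy : y ∈ Icc u v) :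
    |S.W y - S.W x| ≤ S.W v - S.W u := by
  have := S.Wm hx.1; have := S.Wm hx.2; have := S.Wm hy.1; have := S.Wm hy.2
  rw [abs_le]; constructor <;> linarith

lemma Inc.exists_between {a b : ℝ} (h : S.Inc a b) {x y : ℝ} (hx : x ∈ Ioo a b)
    (hy : y ∈ Ioo a b) : ∃ k : ℕ, y ∈ Ioo (S.it (-k) x) (S.it k x) := by
  have h1 := (h.tendsto_fwd hx).eventually (lt_mem_nhds hy.2)
  have h2 := (h.tendsto_bwd hx).eventually (gt_mem_nhds hy.1)
  obtain ⟨k, hk1, hk2⟩ := (h1.and h2).exists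
  exact ⟨k, hk2, hk1⟩

lemma Inc.summable_bound_fwd {a b : ℝ} (h : S.Inc a b) {x : ℝ} (hx : x ∈ Ioo a b) (k : ℕ) :
    Summable (fun j : ℕ => S.W (S.it (j + k) x) - S.W (S.it (j - k) x)) := by
  have hm : Monotone (fun i : ℕ => S.W (S.it (i - k) x)) := fun i j hij =>
    S.Wm ((h.strictMono hx).monotone (by simpa using hij))
  refine (summable_shift hm (C := S.W b) (fun n => S.Wm (h.toCmp.it_mem _ hx).2.le)
    (2 * k)).congr fun j => ?_
  congr 3; push_cast; ring_nf

lemma Inc.summable_bound_bwd {a b : ℝ} (h : S.Inc a b) {x : ℝ} (hx : x ∈ Ioo a b) (k : ℕ) :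
    Summable (fun j : ℕ => S.W (S.it (-(j + 1) + k) x) - S.W (S.it (-(j + 1) - k) x)) := by
  have hm : Monotone (fun i : ℕ => - S.W (S.it (-(i + 1) + k) x)) := fun i j hij =>
    neg_le_neg (S.Wm ((h.strictMono hx).monotone (by omega)))
  refine (summable_shift hm (C := - S.W a)
    (fun n => neg_le_neg (S.Wm (h.toCmp.it_mem _ hx).1.le)) (2 * k)).congr fun j => ?_
  rw [neg_sub_neg]
  congr 3; push_cast; ring_nf

lemma it_shift_mem {k : ℕ} {x y : ℝ} (j : ℤ) (hy : y ∈ Icc (S.it (-k) x) (S.it k x)) :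
    S.it j y ∈ Icc (S.it (j - k) x) (S.it (j + k) x) := by
  rw [sub_eq_add_neg, it_add, it_add]
  exact ⟨(S.it_mono j).monotone hy.1, (S.it_mono j).monotone hy.2⟩

lemma Inc.self_mem {a b : ℝ} (h : S.Inc a b) {x : ℝ} (hx : x ∈ Ioo a b) (k : ℕ) :
    x ∈ Icc (S.it (-k) x) (S.it k x) := by
  have := (h.strictMono hx).monotone
  constructor
  · simpa using this (show -(k:ℤ) ≤ 0 by simp)
  · simpa using this (show 0 ≤ (k:ℤ) by simp)

lemma Inc.summable_W_fwd {a b : ℝ} (h : S.Inc a b) {x y : ℝ} (hx : x ∈ Ioo a b)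
    (hy : y ∈ Ioo a b) : Summable (fun j : ℕ => |S.W (S.it j y) - S.W (S.it j x)|) := by
  obtain ⟨k, hk⟩ := h.exists_between hx hy
  refine Summable.of_nonneg_of_le (fun _ => abs_nonneg _) (fun j => ?_) (h.summable_bound_fwd hx k)
  exact S.abs_W_le (it_shift_mem j (h.self_mem hx k)) (it_shift_mem j (Ioo_subset_Icc_self hk))

lemma Inc.summable_W_bwd {a b : ℝ} (h : S.Inc a b) {x y : ℝ} (hx : x ∈ Ioo a b)
    (hy : y ∈ Ioo a b) :
    Summable (fun j : ℕ => |S.W (S.it (-(j + 1)) y) - S.W (S.it (-(j + 1)) x)|) := by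
  obtain ⟨k, hk⟩ := h.exists_between hx hy
  refine Summable.of_nonneg_of_le (fun _ => abs_nonneg _) (fun j => ?_) (h.summable_bound_bwd hx k)
  exact S.abs_W_le (it_shift_mem _ (h.self_mem hx k)) (it_shift_mem _ (Ioo_subset_Icc_self hk))

lemma Inc.summable_L_fwd {a b : ℝ} (h : S.Inc a b) {x y : ℝ} (hx : x ∈ Ioo a b)
    (hy : y ∈ Ioo a b) : Summable (fun j : ℕ => S.L (S.it j y) - S.L (S.it j x)) :=
  Summable.of_norm_bounded (h.summable_W_fwd hx hy) fun _ => S.abs_L_le _ _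

lemma Inc.summable_L_bwd {a b : ℝ} (h : S.Inc a b) {x y : ℝ} (hx : x ∈ Ioo a b)
    (hy : y ∈ Ioo a b) :
    Summable (fun j : ℕ => S.L (S.it (-(j + 1)) y) - S.L (S.it (-(j + 1)) x)) :=
  Summable.of_norm_bounded (h.summable_W_bwd hx hy) fun _ => S.abs_L_le _ _

variable (S) in
/-- the two-sided sum of differences of `log Df` vanishes -/
def Star (a b : ℝ) : Prop := ∀ x ∈ Ioo a b, ∀ y ∈ uIcc x (S.f x),
  (∑' j : ℕ, (S.L (S.it j y) - S.L (S.it j x))) +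
  (∑' j : ℕ, (S.L (S.it (-(j + 1)) y) - S.L (S.it (-(j + 1)) x))) = 0

end Su

namespace Su
variable {S : Su}

lemma evar_le_of_mono {D H : ℝ → ℝ} {u v : ℝ} (huv : u ≤ v)
    (h : ∀ y z, u ≤ y → y ≤ z → z ≤ v → |D z - D y| ≤ H z - H y) :
    eVariationOn D (Icc u v) ≤ ENNReal.ofReal (H v - H u) := by
  have hm : MonotoneOn H (Icc u v) := fun y hy z hz hyz => by
    have := (abs_nonneg _).trans (h y z hy.1 hyz hz.2); linarith
  calc eVariationOn D (Icc u v) ≤ eVariationOn H (Icc u v) := by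
        refine iSup_le fun ⟨n, w, hw, ws⟩ => ?_
        refine le_trans (Finset.sum_le_sum fun i _ => ?_) (eVariationOn.sum_le hw ws (n := n))
        rw [edist_dist, edist_dist, Real.dist_eq, Real.dist_eq]
        apply ENNReal.ofReal_le_ofReal
        exact (h _ _ (ws i).1 (hw (Nat.le_succ i)) (ws (i+1)).2).trans (le_abs_self _)
    _ = _ := by
        have := hm.eVariationOn_eq (left_mem_Icc.2 huv) (right_mem_Icc.2 huv)
        rwa [inter_self] at this

variable (S) in
def ell (c x : ℝ) : ℝ := ∑' j : ℕ, (S.L (S.it j c) - S.L (S.it j x))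

lemma Inc.ell_sub {a b c x y : ℝ} (h : S.Inc a b) (hc : c ∈ Ioo a b) (hx : x ∈ Ioo a b)
    (hy : y ∈ Ioo a b) :
    S.ell c y - S.ell c x = ∑' j : ℕ, (S.L (S.it j x) - S.L (S.it j y)) := by
  rw [ell, ell, ← (h.summable_L_fwd hy hc).tsum_sub (h.summable_L_fwd hx hc)]
  congr 1; ext j; ring

lemma Cmp.f_mem {a b : ℝ} (h : S.Cmp a b) {x : ℝ} (hx : x ∈ Ioo a b) : S.f x ∈ Ioo a b := by
  simpa using h.it_mem 1 hx

lemma Inc.ell_f {a b c x : ℝ} (h : S.Inc a b) (hc : c ∈ Ioo a b) (hx : x ∈ Ioo a b) :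
    S.ell c (S.f x) = S.ell c x + S.L x := by
  have hfx := h.toCmp.f_mem hx
  have h1 := (h.summable_L_fwd hfx hx).hasSum.tendsto_sum_nat
  rw [← h.ell_sub hc hx hfx] at h1
  have h2 : Tendsto (fun n : ℕ => S.L x - S.L (S.it n x)) atTop (𝓝 (S.L x - S.L b)) :=
    tendsto_const_nhds.sub ((S.Lc.tendsto b).comp (h.tendsto_fwd hx))
  rw [S.Lfix b h.fb] at h2
  have h3 := tendsto_nhds_unique h1 (h2.congr fun n => ?_)
  · linarith
  · have := Finset.sum_range_sub' (fun j : ℕ => S.L (S.it j x)) n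
    simp only [Nat.cast_zero, it_zero] at this
    rw [← this]
    refine Finset.sum_congr rfl fun j _ => ?_
    rw [← it_succ']; push_cast; rfl

lemma Inc.ell_cont {a b c : ℝ} (h : S.Inc a b) (hc : c ∈ Ioo a b) :
    ContinuousOn (S.ell c) (Ioo a b) := by
  intro x hx
  obtain ⟨k, hk⟩ := h.exists_between hc hx
  have : ContinuousOn (S.ell c) (Icc (S.it (-k) c) (S.it k c)) := by
    refine continuousOn_tsum (u := fun j : ℕ => S.W (S.it (j + k) c) - S.W (S.it (j - k) c))
      (fun j => ?_) (h.summable_bound_fwd hc k) fun j y hy => ?_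
    · exact (continuous_const.sub (S.Lc.comp (S.it_cont j))).continuousOn
    · exact (S.abs_L_le _ _).trans
        (S.abs_W_le (it_shift_mem j hy) (it_shift_mem j (h.self_mem hc k)))
  exact (this.continuousAt (Icc_mem_nhds hk.1 hk.2)).continuousWithinAt

lemma abs_tsum_le {u v : ℕ → ℝ} (hv : Summable v) (h : ∀ j, |u j| ≤ v j) :
    |∑' j, u j| ≤ ∑' j, v j := by
  rw [← Real.norm_eq_abs]; exact tsum_of_norm_bounded hv.hasSum h

lemma Inc.var_ell_fwd {a b c x : ℝ} (h : S.Inc a b) (hc : c ∈ Ioo a b) (hx : x ∈ Ioo a b) :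
    eVariationOn (S.ell c) (Icc x (S.f x)) ≤ ENNReal.ofReal (S.W b - S.W x) := by
  have hfx := h.toCmp.f_mem hx
  set H : ℝ → ℝ := fun y => ∑' j : ℕ, (S.W (S.it j y) - S.W (S.it j x)) with hH
  refine (evar_le_of_mono (H := H) (h.lt x hx).le ?_).trans (ENNReal.ofReal_le_ofReal ?_)
  · intro y z hy hyz hz
    have hyI : y ∈ Ioo a b := ⟨hx.1.trans_le hy, (hyz.trans hz).trans_lt hfx.2⟩
    have hzI : z ∈ Ioo a b := ⟨hx.1.trans_le (hy.trans hyz), hz.trans_lt hfx.2⟩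
    rw [h.ell_sub hc hyI hzI, hH]
    simp only
    rw [← (h.summable_W_fwd hx hzI).of_abs.tsum_sub (h.summable_W_fwd hx hyI).of_abs]
    refine abs_tsum_le ((h.summable_W_fwd hx hzI).of_abs.sub (h.summable_W_fwd hx hyI).of_abs) ?_
    intro j
    rw [abs_sub_comm]
    have := S.LW _ _ ((S.it_mono j).monotone hyz)
    linarith
  · have h0 : H x = 0 := by simp [hH]
    rw [h0, sub_zero]
    refine Real.tsum_le_of_sum_range_le (fun j => sub_nonneg.2 (S.Wm ((S.it_mono j).monotone
      (h.lt x hx).le))) fun n => ?_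
    have := Finset.sum_range_sub (fun j : ℕ => S.W (S.it j x)) n
    simp only [Nat.cast_zero, it_zero] at this
    have h2 := S.Wm (h.toCmp.it_mem n hx).2.le
    have h3 : ∑ i ∈ Finset.range n, (S.W (S.it i (S.f x)) - S.W (S.it i x)) =
        S.W (S.it n x) - S.W x := by
      rw [← this]
      refine Finset.sum_congr rfl fun j _ => ?_
      rw [← it_succ']; push_cast; rfl
    linarith

lemma Inc.var_ell_bwd {a b c x : ℝ} (h : S.Inc a b) (hs : S.Star a b) (hc : c ∈ Ioo a b)
    (hx : x ∈ Ioo a b) :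
    eVariationOn (S.ell c) (Icc x (S.f x)) ≤ ENNReal.ofReal (S.W x - S.W a) := by
  have hfx := h.toCmp.f_mem hx
  set H : ℝ → ℝ := fun y => ∑' j : ℕ, (S.W (S.it (-(j+1)) y) - S.W (S.it (-(j+1)) x)) with hH
  refine (evar_le_of_mono (H := H) (h.lt x hx).le ?_).trans (ENNReal.ofReal_le_ofReal ?_)
  · intro y z hy hyz hz
    have hyI : y ∈ Ioo a b := ⟨hx.1.trans_le hy, (hyz.trans hz).trans_lt hfx.2⟩
    have hzI : z ∈ Ioo a b := ⟨hx.1.trans_le (hy.trans hyz), hz.trans_lt hfx.2⟩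
    have hst := hs y hyI z (by
      rw [uIcc_of_le (h.lt y hyI).le]; exact ⟨hyz, hz.trans (S.f.monotone hy)⟩)
    have h1 : S.ell c z - S.ell c y =
        ∑' j : ℕ, (S.L (S.it (-(j + 1)) z) - S.L (S.it (-(j + 1)) y)) := by
      have h2 := h.ell_sub hc hzI hyI
      linarith
    rw [h1, hH]
    simp only
    rw [← (h.summable_W_bwd hx hzI).of_abs.tsum_sub (h.summable_W_bwd hx hyI).of_abs]
    refine abs_tsum_le ((h.summable_W_bwd hx hzI).of_abs.sub (h.summable_W_bwd hx hyI).of_abs) ?_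
    intro j
    have := S.LW _ _ ((S.it_mono (-(j+1))).monotone hyz)
    linarith
  · have h0 : H x = 0 := by simp [hH]
    rw [h0, sub_zero]
    refine Real.tsum_le_of_sum_range_le (fun j => sub_nonneg.2 (S.Wm ((S.it_mono _).monotone
      (h.lt x hx).le))) fun n => ?_
    have := Finset.sum_range_sub' (fun j : ℕ => S.W (S.it (-j) x)) n
    simp only [Nat.cast_zero, neg_zero, it_zero] at this
    have h2 := S.Wm (h.toCmp.it_mem (-n) hx).1.le
    have h3 : ∑ i ∈ Finset.range n, (S.W (S.it (-(i+1)) (S.f x)) - S.W (S.it (-(i+1)) x)) =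
        S.W x - S.W (S.it (-n) x) := by
      rw [← this]
      refine Finset.sum_congr rfl fun j _ => ?_
      rw [← it_succ']; push_cast; congr 3; ring
    linarith

lemma abs_le_of_evar {D : ℝ → ℝ} {s : Set ℝ} {C x y : ℝ} (hC : 0 ≤ C)
    (h : eVariationOn D s ≤ ENNReal.ofReal C) (hx : x ∈ s) (hy : y ∈ s) : |D x - D y| ≤ C := by
  have := (eVariationOn.edist_le D hx hy).trans h
  rw [edist_dist, Real.dist_eq] at this
  exact (ENNReal.ofReal_le_ofReal_iff hC).1 this

end Su

namespace Su
variable {S : Su}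

variable (S) in
def SmallVar (a b : ℝ) : Prop := ∀ ε > (0:ℝ), ∀ᶠ n : ℕ in atTop,
  eVariationOn (S.g n) (Icc a b) ≤ ENNReal.ofReal (ε * n)

lemma g_diff (x y : ℝ) (k m : ℕ) :
    S.g (k + m) (S.it (-k) y) - S.g (k + m) (S.it (-k) x) =
    (∑ i ∈ Finset.range k, (S.L (S.it (-(i + 1)) y) - S.L (S.it (-(i + 1)) x))) +
    ∑ i ∈ Finset.range m, (S.L (S.it i y) - S.L (S.it i x)) := by
  rw [g, g, ← Finset.sum_sub_distrib, Finset.sum_range_add, ← Finset.sum_range_reflect]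
  congr 1
  · refine Finset.sum_congr rfl fun j hj => ?_
    have hj := Finset.mem_range.1 hj
    rw [← it_add, ← it_add]
    have : ((k - 1 - j : ℕ) : ℤ) + -(k:ℤ) = -(j + 1) := by omega
    rw [this]
  · refine Finset.sum_congr rfl fun j hj => ?_
    rw [← it_add, ← it_add]
    have : ((k + j : ℕ) : ℤ) + -(k:ℤ) = j := by omega
    rw [this]

lemma Inc.star_of_smallVar {a b : ℝ} (h : S.Inc a b) (hv : S.SmallVar a b) : S.Star a b := by
  intro x hx y hy
  rw [uIcc_of_le (h.lt x hx).le] at hy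
  have hfx := h.toCmp.f_mem hx
  have hyI : y ∈ Ioo a b := ⟨hx.1.trans_le hy.1, hy.2.trans_lt hfx.2⟩
  have hF := (h.summable_L_fwd hx hyI).hasSum.tendsto_sum_nat
  have hB := (h.summable_L_bwd hx hyI).hasSum.tendsto_sum_nat
  set P := ∑' j : ℕ, (S.L (S.it j y) - S.L (S.it j x))
  set Q := ∑' j : ℕ, (S.L (S.it (-(j + 1)) y) - S.L (S.it (-(j + 1)) x))
  by_contra hne
  have hpos : 0 < |P + Q| := abs_pos.2 hne
  set σ := |P + Q| with hσ
  obtain ⟨N1, hN1⟩ := Metric.tendsto_atTop.1 hF (σ / 4) (by positivity)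
  obtain ⟨N2, hN2⟩ := Metric.tendsto_atTop.1 hB (σ / 4) (by positivity)
  set N := max N1 N2
  have key : ∀ k m : ℕ, N ≤ k → N ≤ m →
      σ / 2 ≤ |S.g (k + m) (S.it (-k) y) - S.g (k + m) (S.it (-k) x)| := by
    intro k m hk hm
    rw [g_diff]
    have h1 := hN1 m ((le_max_left _ _).trans hm)
    have h2 := hN2 k ((le_max_right _ _).trans hk)
    rw [Real.dist_eq] at h1 h2
    set p := ∑ i ∈ Finset.range m, (S.L (S.it i y) - S.L (S.it i x))
    set q := ∑ i ∈ Finset.range k, (S.L (S.it (-(i + 1)) y) - S.L (S.it (-(i + 1)) x))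
    have h3 : σ ≤ |q + p| + |p - P| + |q - Q| := by
      rw [hσ]
      have : P + Q = (q + p) - (p - P) - (q - Q) := by ring
      rw [this]
      exact (abs_sub _ _).trans (add_le_add_left (abs_sub _ _) _)
    linarith
  obtain ⟨n, hn, hn4⟩ := ((hv (σ / 8) (by positivity)).and (eventually_ge_atTop (4 * N + 4))).exists
  set I : ℕ → ℝ := fun i => S.it ((i : ℤ) - (n - N : ℕ)) x with hI
  have hIm : Monotone I := fun i j hij => (h.strictMono hx).monotone (by omega)
  have hsum := eVariationOn.sum' (S.g n) hIm (n := n - 2 * N)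
  have hle : eVariationOn (S.g n) (Icc (I 0) (I (n - 2 * N))) ≤ eVariationOn (S.g n) (Icc a b) :=
    eVariationOn.mono _ (Icc_subset_Icc (h.toCmp.it_mem _ hx).1.le (h.toCmp.it_mem _ hx).2.le)
  have hge : ∑ i ∈ Finset.range (n - 2 * N), ENNReal.ofReal (σ / 2) ≤
      ∑ i ∈ Finset.range (n - 2 * N), eVariationOn (S.g n) (Icc (I i) (I (i + 1))) := by
    refine Finset.sum_le_sum fun i hi => ?_
    have hi := Finset.mem_range.1 hi
    have h1 := key (n - N - i) (N + i) (by omega) (by omega)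
    rw [show n - N - i + (N + i) = n by omega] at h1
    have e1 : I i = S.it (-((n - N - i : ℕ) : ℤ)) x := by
      rw [hI]; simp only; congr 1; omega
    have e2 : I (i + 1) = S.it (-((n - N - i : ℕ) : ℤ)) (S.f x) := by
      rw [← it_succ', hI]; simp only; congr 1; omega
    refine le_trans ?_ (eVariationOn.edist_le (S.g n)
      (x := S.it (-((n - N - i : ℕ) : ℤ)) y) (y := S.it (-((n - N - i : ℕ) : ℤ)) x) ?_ ?_)
    · rw [edist_dist, Real.dist_eq]; exact ENNReal.ofReal_le_ofReal h1
    · rw [e1, e2]; exact ⟨(S.it_mono _).monotone hy.1, (S.it_mono _).monotone hy.2⟩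
    · rw [← e1]; exact ⟨le_rfl, hIm (Nat.le_succ i)⟩
  have hfin := (hge.trans_eq hsum).trans (hle.trans hn)
  rw [Finset.sum_const, Finset.card_range, ← ENNReal.ofReal_nsmul,
    ENNReal.ofReal_le_ofReal_iff (by positivity), nsmul_eq_mul, Nat.cast_sub (by omega)] at hfin
  push_cast at hfin
  have hn4' : (4 * N + 4 : ℝ) ≤ n := by exact_mod_cast hn4
  nlinarith

variable (S) in
/-- a local `C¹` flow on a component, whose time-one map is `f`, with control at the ends -/
structure LF (a b : ℝ) (φ ψ : ℝ → ℝ → ℝ) : Prop where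
  mem : ∀ t, ∀ x ∈ Ioo a b, φ t x ∈ Ioo a b
  zero : ∀ x ∈ Ioo a b, φ 0 x = x
  add : ∀ t u, ∀ x ∈ Ioo a b, φ (t + u) x = φ t (φ u x)
  one : ∀ x ∈ Ioo a b, φ 1 x = S.f x
  mono : ∀ t, MonotoneOn (φ t) (Ioo a b)
  hd : ∀ t, ∀ x ∈ Ioo a b, HasDerivAt (φ t) (Real.exp (ψ t x)) x
  psi_add : ∀ t u, ∀ x ∈ Ioo a b, ψ (t + u) x = ψ t (φ u x) + ψ u x
  phic : ∀ t, ∀ x ∈ Ioo a b, ContinuousAt (Function.uncurry φ) (t, x)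
  psic : ∀ t, ∀ x ∈ Ioo a b, ContinuousAt (Function.uncurry ψ) (t, x)
  btw : ∀ t ∈ Icc (0:ℝ) 1, ∀ x ∈ Ioo a b, φ t x ∈ uIcc x (S.f x)
  bda : ∀ t ∈ Icc (0:ℝ) 1, ∀ x ∈ Ioo a b, |ψ t x| ≤ |S.W x - S.W a| + |S.W (S.f x) - S.W a|
  bdb : ∀ t ∈ Icc (0:ℝ) 1, ∀ x ∈ Ioo a b, |ψ t x| ≤ |S.W x - S.W b| + |S.W (S.f x) - S.W b|

lemma Inc.exists_LF {a b : ℝ} (h : S.Inc a b) (hs : S.Star a b) : ∃ φ ψ, S.LF a b φ ψ := by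
  obtain ⟨c, hc⟩ : (Ioo a b).Nonempty := nonempty_Ioo.2 h.ab
  set l := S.ell c with hl
  have lc : ContinuousOn l (Ioo a b) := h.ell_cont hc
  set E : ℝ → ℝ := fun x => Real.exp (-l x) with hE
  have Ec : ContinuousOn E (Ioo a b) := lc.neg.rexp
  set θ₀ : ℝ → ℝ := fun x => ∫ u in c..x, E u with hθ₀
  have hd0 : ∀ x ∈ Ioo a b, HasDerivAt θ₀ (E x) x := by
    intro x hx
    refine intervalIntegral.integral_hasDerivAt_right ?_ ?_ (Ec.continuousAt (isOpen_Ioo.mem_nhds hx))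
    · exact (Ec.mono (fun z hz => by
        have := uIcc_subset_Icc (Ioo_subset_Icc_self hc) (Ioo_subset_Icc_self hx) hz
        exact (ordConnected_Ioo.uIcc_subset hc hx) hz)).intervalIntegrable
    · exact Ec.stronglyMeasurableAtFilter isOpen_Ioo x hx
  have hconst : ∀ x ∈ Ioo a b, θ₀ (S.f x) - θ₀ x = θ₀ (S.f c) - θ₀ c := by
    intro x hx
    have hD : ∀ z ∈ Ioo a b, HasDerivAt (fun z => θ₀ (S.f z) - θ₀ z) 0 z := by
      intro z hz
      have h1 := ((hd0 _ (h.toCmp.f_mem hz)).comp z (S.hd z)).sub (hd0 z hz)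
      have e : E (S.f z) * Real.exp (S.L z) - E z = 0 := by
        simp only [hE]
        rw [hl, h.ell_f hc hz, ← Real.exp_add]
        simp
      rw [e] at h1
      exact h1
    have hdiff : DifferentiableOn ℝ (fun z => θ₀ (S.f z) - θ₀ z) (Ioo a b) :=
      fun z hz => (hD z hz).differentiableAt.differentiableWithinAt
    exact isOpen_Ioo.is_const_of_deriv_eq_zero (isPreconnected_Ioo) hdiff
      (fun z hz => (hD z hz).deriv) hx hc
  have hmono0 : StrictMonoOn θ₀ (Ioo a b) := by
    refine strictMonoOn_of_deriv_pos (convex_Ioo a b)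
      (fun z hz => (hd0 z hz).continuousAt.continuousWithinAt) fun z hz => ?_
    rw [interior_Ioo] at hz
    rw [(hd0 z hz).deriv]
    exact Real.exp_pos _
  set T := θ₀ (S.f c) - θ₀ c with hT
  have Tpos : 0 < T := sub_pos.2 (hmono0 hc (h.toCmp.f_mem hc) (h.lt c hc))
  set θ : ℝ → ℝ := fun x => θ₀ x / T with hθ
  have hdθ : ∀ x ∈ Ioo a b, HasDerivAt θ (E x / T) x := fun x hx => (hd0 x hx).div_const T
  have θf : ∀ x ∈ Ioo a b, θ (S.f x) = θ x + 1 := by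
    intro x hx
    simp only [hθ]
    field_simp
    linarith [hconst x hx]
  have θm : StrictMonoOn θ (Ioo a b) := fun x hx y hy hxy =>
    div_lt_div_of_pos_right (hmono0 hx hy hxy) Tpos
  have θit : ∀ k : ℤ, θ (S.it k c) = k := by
    intro k
    induction k using Int.induction_on with
    | zero => simp [hθ, hθ₀]
    | succ n ih => rw [it_succ, θf _ (h.toCmp.it_mem _ hc), ih]; push_cast; ring
    | pred n ih =>
      have := θf _ (h.toCmp.it_mem (-(n:ℤ) - 1) hc)
      rw [← it_succ, sub_add_cancel, ih] at this
      push_cast at this ⊢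
      linarith
  have surj : ∀ s : ℝ, ∃ x ∈ Ioo a b, θ x = s := by
    intro s
    obtain ⟨n, hn⟩ := exists_nat_gt |s|
    have hs := abs_lt.1 hn
    have hsub : Icc (S.it (-n) c) (S.it n c) ⊆ Ioo a b :=
      ordConnected_Ioo.out (h.toCmp.it_mem _ hc) (h.toCmp.it_mem _ hc)
    have := intermediate_value_Icc (f := θ) ((h.self_mem hc n).1.trans (h.self_mem hc n).2)
      (fun z hz => (hdθ z (hsub hz)).continuousAt.continuousWithinAt)
    obtain ⟨x, hx, hxs⟩ := this (show s ∈ Icc (θ (S.it (-n) c)) (θ (S.it n c)) by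
      rw [θit, θit]; push_cast; exact ⟨hs.1.le, hs.2.le⟩)
    exact ⟨x, hsub hx, hxs⟩
  choose η ηI θη using surj
  have ηθ : ∀ x ∈ Ioo a b, η (θ x) = x := fun x hx => θm.injOn (ηI _) hx (θη _)
  have ηm : StrictMono η := by
    intro s t hst
    rw [← θm.lt_iff_lt (ηI s) (ηI t), θη, θη]; exact hst
  have ηc : Continuous η := by
    rw [continuous_iff_continuousAt]
    intro s
    refine (ηm.strictMonoOn univ).continuousAt_of_image_mem_nhds univ_mem ?_
    refine mem_of_superset (isOpen_Ioo.mem_nhds (ηI s)) fun x hx => ⟨θ x, trivial, ηθ x hx⟩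
  have hdη : ∀ s, HasDerivAt η (E (η s) / T)⁻¹ s := fun s =>
    HasDerivAt.of_local_left_inverse ηc.continuousAt (hdθ _ (ηI s))
      (div_pos (Real.exp_pos _) Tpos).ne' (Eventually.of_forall θη)
  have btw : ∀ t ∈ Icc (0:ℝ) 1, ∀ x ∈ Ioo a b, η (θ x + t) ∈ Icc x (S.f x) := by
    intro t ht x hx
    constructor
    · conv_lhs => rw [← ηθ x hx]
      exact ηm.monotone (by linarith [ht.1])
    · conv_rhs => rw [← ηθ _ (h.toCmp.f_mem hx), θf x hx]
      exact ηm.monotone (by linarith [ht.2])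
  have phic : ∀ t, ∀ x ∈ Ioo a b,
      ContinuousAt (Function.uncurry fun t x => η (θ x + t)) (t, x) := by
    intro t x hx
    refine ContinuousAt.comp (g := η) ηc.continuousAt ?_
    refine ContinuousAt.add ?_ continuousAt_fst
    exact ContinuousAt.comp (f := Prod.snd) (g := θ) (x := (t, x)) (hdθ x hx).continuousAt
      continuousAt_snd
  refine ⟨fun t x => η (θ x + t), fun t x => l (η (θ x + t)) - l x, ?_⟩
  constructor
  · intro t x hx; exact ηI _
  · intro x hx; simp [ηθ x hx]
  · intro t u x hx; rw [θη]; congr 1; ring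
  · intro x hx; rw [← θf x hx, ηθ _ (h.toCmp.f_mem hx)]
  · intro t x hx y hy hxy
    exact ηm.monotone (by linarith [θm.monotoneOn hx hy hxy])
  · intro t x hx
    have h1 := (hdη (θ x + t)).comp x ((hdθ x hx).add_const t)
    have e : (E (η (θ x + t)) / T)⁻¹ * (E x / T) = Real.exp (l (η (θ x + t)) - l x) := by
      have : Real.exp (l (η (θ x + t)) - l x) = (E (η (θ x + t)))⁻¹ * E x := by
        simp only [hE]
        rw [← Real.exp_neg, ← Real.exp_add]; congr 1; ring
      rw [this]
      field_simp
    rw [e] at h1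
    exact h1
  · intro t u x hx; rw [θη]
    have : θ x + u + t = θ x + (t + u) := by ring
    rw [this]; ring
  · exact phic
  · intro t x hx
    refine ContinuousAt.sub ?_ ?_
    · exact ContinuousAt.comp (g := l) (lc.continuousAt (isOpen_Ioo.mem_nhds (ηI _))) (phic t x hx)
    · exact ContinuousAt.comp (f := Prod.snd) (g := l) (x := (t, x))
        (lc.continuousAt (isOpen_Ioo.mem_nhds hx)) continuousAt_snd
  · intro t ht x hx
    rw [uIcc_of_le (h.lt x hx).le]; exact btw t ht x hx
  · intro t ht x hx
    have h0 : 0 ≤ S.W x - S.W a := sub_nonneg.2 (S.Wm hx.1.le)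
    have := abs_le_of_evar h0 (h.var_ell_bwd hs hc hx) (btw t ht x hx)
      (left_mem_Icc.2 (h.lt x hx).le)
    have h2 := le_abs_self (S.W x - S.W a)
    have h3 := abs_nonneg (S.W (S.f x) - S.W a)
    exact this.trans (by linarith)
  · intro t ht x hx
    have h0 : 0 ≤ S.W b - S.W x := sub_nonneg.2 (S.Wm hx.2.le)
    have := abs_le_of_evar h0 (h.var_ell_fwd hc hx) (btw t ht x hx)
      (left_mem_Icc.2 (h.lt x hx).le)
    have h2 := neg_abs_le (S.W x - S.W b)
    have h3 := abs_nonneg (S.W (S.f x) - S.W b)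
    exact this.trans (by linarith)

end Su

namespace Su
variable {S : Su}

lemma evar_le_of_abs {D D' : ℝ → ℝ} {s : Set ℝ}
    (h : ∀ y ∈ s, ∀ z ∈ s, |D z - D y| ≤ |D' z - D' y|) :
    eVariationOn D s ≤ eVariationOn D' s := by
  refine iSup_le fun ⟨n, w, hw, ws⟩ => ?_
  refine le_trans (Finset.sum_le_sum fun i _ => ?_) (eVariationOn.sum_le hw ws (n := n))
  rw [edist_dist, edist_dist, Real.dist_eq, Real.dist_eq]
  exact ENNReal.ofReal_le_ofReal (h _ (ws i) _ (ws (i+1)))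

lemma evar_add (p q : ℝ → ℝ) (s : Set ℝ) :
    eVariationOn (fun x => p x + q x) s ≤ eVariationOn p s + eVariationOn q s := by
  refine iSup_le fun ⟨n, w, hw, ws⟩ => ?_
  refine le_trans (Finset.sum_le_sum fun i _ => edist_add_add_le _ _ _ _) ?_
  rw [Finset.sum_add_distrib]
  exact add_le_add (eVariationOn.sum_le hw ws) (eVariationOn.sum_le hw ws)

lemma evar_sub (p q : ℝ → ℝ) (s : Set ℝ) :
    eVariationOn (fun x => p x - q x) s ≤ eVariationOn p s + eVariationOn q s := by
  have h := evar_add p (fun x => - q x) s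
  simp only [← sub_eq_add_neg] at h
  refine h.trans (add_le_add_right (evar_le_of_abs fun y _ z _ => ?_) _)
  rw [show - q z - - q y = -(q z - q y) by ring, abs_neg]

lemma evar_sum (p : ℕ → ℝ → ℝ) (s : Set ℝ) (n : ℕ) :
    eVariationOn (fun x => ∑ j ∈ Finset.range n, p j x) s ≤
      ∑ j ∈ Finset.range n, eVariationOn (p j) s := by
  induction n with
  | zero =>
    simp only [Finset.range_zero, Finset.sum_empty]
    rw [eVariationOn.constant_on]
    rintro _ ⟨_, _, rfl⟩ _ ⟨_, _, rfl⟩; rfl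
  | succ n ih =>
    simp only [Finset.sum_range_succ]
    exact (evar_add _ _ s).trans (add_le_add_left ih _)

lemma evar_split (D : ℝ → ℝ) {x y z : ℝ} (hxy : x ≤ y) (hyz : y ≤ z) :
    eVariationOn D (Icc x z) = eVariationOn D (Icc x y) + eVariationOn D (Icc y z) := by
  simpa using (eVariationOn.Icc_add_Icc D (s := univ) hxy hyz (mem_univ y)).symm

lemma evar_L (S : Su) {x y : ℝ} (h : x ≤ y) :
    eVariationOn S.L (Icc x y) ≤ ENNReal.ofReal (S.W y - S.W x) :=
  evar_le_of_mono h fun _ _ _ hyz _ => S.LW _ _ hyz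

lemma Inc.smallVar_of_star {a b : ℝ} (h : S.Inc a b) (hs : S.Star a b) : S.SmallVar a b := by
  intro ε hε
  obtain ⟨c, hc⟩ : (Ioo a b).Nonempty := nonempty_Ioo.2 h.ab
  have ht1 := ((S.Wc.tendsto b).comp (h.tendsto_fwd hc)).eventually
    (lt_mem_nhds (show S.W b - ε / 8 < S.W b by linarith))
  have ht2 := ((S.Wc.tendsto a).comp (h.tendsto_bwd hc)).eventually
    (gt_mem_nhds (show S.W a < S.W a + ε / 8 by linarith))
  obtain ⟨N, ⟨hN1, hN2⟩, hN⟩ := ((ht1.and ht2).and (eventually_ge_atTop 1)).exists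
  simp only [Function.comp] at hN1 hN2
  set l := S.ell c with hl
  set lo := S.it (-N) c with hlo
  set lo' := S.it (-N - 1) c with hlo'
  set hi := S.it N c with hhi
  set hi' := S.it (N - 1) c with hhi'
  have loI : lo ∈ Ioo a b := h.toCmp.it_mem _ hc
  have lo'I : lo' ∈ Ioo a b := h.toCmp.it_mem _ hc
  have hiI : hi ∈ Ioo a b := h.toCmp.it_mem _ hc
  have hi'I : hi' ∈ Ioo a b := h.toCmp.it_mem _ hc
  have flo' : S.f lo' = lo := by rw [hlo', hlo, ← it_succ]; congr 1; ring
  have fhi' : S.f hi' = hi := by rw [hhi', hhi, ← it_succ]; congr 1; ring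
  have sm := (h.strictMono hc).monotone
  have lolo : lo' ≤ lo := sm (by omega)
  have lohi' : lo ≤ hi' := sm (by omega)
  have hihi : hi' ≤ hi := sm (by omega)
  have lohi : lo ≤ hi := lohi'.trans hihi
  have lf : ∀ x ∈ Ioo a b, l (S.f x) = l x + S.L x := fun x hx => h.ell_f hc hx
  set u : ℝ → ℝ := fun x => l (max lo (min x hi)) with hu
  have u1 : ∀ x, x ≤ lo → u x = l lo := fun x hx => by
    simp only [hu]; rw [max_eq_left ((min_le_left _ _).trans hx)]
  have u2 : ∀ x, lo ≤ x → x ≤ hi → u x = l x := fun x hx hx' => by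
    simp only [hu]; rw [min_eq_left hx', max_eq_right hx]
  have u3 : ∀ x, hi ≤ x → u x = l hi := fun x hx => by
    simp only [hu]; rw [min_eq_right hx, max_eq_right lohi]
  set L' : ℝ → ℝ := fun x => S.L x - u (S.f x) + u x with hL'
  have hWlo' : S.W lo' - S.W a ≤ ε / 8 := by have := S.Wm lolo; linarith
  have hWlo : S.W lo - S.W a ≤ ε / 8 := by linarith
  have hWhi : S.W b - S.W hi ≤ ε / 8 := by linarith
  -- variation of `L'`
  have v1 : eVariationOn L' (Icc a lo') ≤ ENNReal.ofReal (ε / 8) := by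
    refine le_trans (evar_le_of_abs (D' := S.L) fun y hy z hz => ?_)
      ((S.evar_L lo'I.1.le).trans (ENNReal.ofReal_le_ofReal hWlo'))
    have e : ∀ y ∈ Icc a lo', L' y = S.L y := fun y hy => by
      simp only [hL']
      rw [u1 y (hy.2.trans lolo), u1 (S.f y) (by rw [← flo']; exact S.f.monotone hy.2)]; ring
    rw [e y hy, e z hz]
  have v2 : eVariationOn L' (Icc lo' lo) ≤ ENNReal.ofReal (ε / 8) := by
    refine le_trans (evar_le_of_abs (D' := l) fun y hy z hz => ?_)
      ((flo' ▸ h.var_ell_bwd hs hc lo'I).trans (ENNReal.ofReal_le_ofReal hWlo'))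
    have e : ∀ y ∈ Icc lo' lo, L' y = l lo - l y := fun y hy => by
      simp only [hL']
      rw [u1 y hy.2, u2 (S.f y) (by rw [← flo']; exact S.f.monotone hy.1)
        (by rw [← fhi']; exact S.f.monotone (hy.2.trans lohi')),
        lf y (ordConnected_Ioo.out lo'I loI hy)]; ring
    rw [e y hy, e z hz, show l lo - l z - (l lo - l y) = -(l z - l y) by ring, abs_neg]
  have v3 : eVariationOn L' (Icc lo hi') ≤ 0 := by
    refine le_of_eq ((eVariationOn.eq_zero_iff _).2 fun y hy z hz => ?_)
    have e : ∀ y ∈ Icc lo hi', L' y = 0 := fun y hy => by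
      have hyI := ordConnected_Ioo.out loI hi'I hy
      simp only [hL']
      rw [u2 y hy.1 (hy.2.trans hihi), u2 (S.f y) (hy.1.trans (h.lt y hyI).le)
        (by rw [← fhi']; exact S.f.monotone hy.2), lf y hyI]; ring
    rw [e y hy, e z hz, edist_self]
  have v4 : eVariationOn L' (Icc hi' hi) ≤ ENNReal.ofReal (ε / 8) := by
    refine le_trans (evar_le_of_abs (D' := l ∘ S.f) fun y hy z hz => ?_)
      ((eVariationOn.comp_le_of_monotoneOn l (s := Icc hi (S.f hi)) S.f
        (S.f.monotone.monotoneOn _) ?_).trans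
        ((h.var_ell_fwd hc hiI).trans (ENNReal.ofReal_le_ofReal hWhi)))
    · have e : ∀ y ∈ Icc hi' hi, L' y = l (S.f y) - l hi := fun y hy => by
        have hyI := ordConnected_Ioo.out hi'I hiI hy
        simp only [hL']
        rw [u2 y (lohi'.trans hy.1) hy.2, u3 (S.f y) (by rw [← fhi']; exact S.f.monotone hy.1),
          lf y hyI]; ring
      rw [e y hy, e z hz]
      simp
    · intro y hy
      exact ⟨by rw [← fhi']; exact S.f.monotone hy.1, S.f.monotone hy.2⟩
  have v5 : eVariationOn L' (Icc hi b) ≤ ENNReal.ofReal (ε / 8) := by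
    refine le_trans (evar_le_of_abs (D' := S.L) fun y hy z hz => ?_)
      ((S.evar_L hiI.2.le).trans (ENNReal.ofReal_le_ofReal hWhi))
    have e : ∀ y ∈ Icc hi b, L' y = S.L y := fun y hy => by
      simp only [hL']
      rw [u3 y hy.1, u3 (S.f y) ((h.lt hi hiI).le.trans (S.f.monotone hy.1))]; ring
    rw [e y hy, e z hz]
  have vL' : eVariationOn L' (Icc a b) ≤ ENNReal.ofReal (ε / 2) := by
    rw [evar_split L' loI.1.le loI.2.le, evar_split L' lo'I.1.le lolo,
      evar_split L' lohi hiI.2.le, evar_split L' lohi' hihi]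
    have : ENNReal.ofReal (ε / 2) = ENNReal.ofReal (ε / 8) + ENNReal.ofReal (ε / 8) +
        (0 + ENNReal.ofReal (ε / 8) + ENNReal.ofReal (ε / 8)) := by
      rw [zero_add, ← ENNReal.ofReal_add (by positivity) (by positivity),
        ← ENNReal.ofReal_add (by positivity) (by positivity)]
      congr 1; ring
    rw [this]
    gcongr
  -- variation of `u`
  have vu : eVariationOn u (Icc a b) ≠ ⊤ := by
    have h1 : eVariationOn u (Icc a b) ≤ eVariationOn l (Icc lo hi) :=
      eVariationOn.comp_le_of_monotoneOn l (fun x => max lo (min x hi))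
        (fun x _ y _ hxy => max_le_max le_rfl (min_le_min hxy le_rfl))
        (fun x _ => ⟨le_max_left _ _, max_le lohi (min_le_right _ _)⟩)
    set I : ℕ → ℝ := fun i => S.it ((i : ℤ) - N) c with hI
    have hIm : Monotone I := fun i j hij => sm (by omega)
    have h2 := eVariationOn.sum' l hIm (n := 2 * N)
    have e1 : I 0 = lo := by simp only [hI, hlo]; congr 1; omega
    have e2 : I (2 * N) = hi := by simp only [hI, hhi]; congr 1; omega
    rw [e1, e2] at h2
    refine ne_top_of_le_ne_top ?_ h1
    rw [← h2]
    refine (ENNReal.sum_lt_top.2 fun i _ => ?_).ne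
    have hIi : I i ∈ Ioo a b := h.toCmp.it_mem _ hc
    have e3 : I (i + 1) = S.f (I i) := by simp only [hI]; rw [← it_succ]; congr 1; omega
    rw [e3]
    exact (h.var_ell_fwd hc hIi).trans_lt ENNReal.ofReal_lt_top
  have hg : ∀ n x, S.g n x = (∑ j ∈ Finset.range n, L' (S.it j x)) + u (S.it n x) - u x := by
    intro n x
    induction n with
    | zero => simp [g]
    | succ n ih =>
      have : S.g (n + 1) x = S.g n x + S.L (S.it n x) := by simp [g, Finset.sum_range_succ]
      rw [this, ih, Finset.sum_range_succ]
      push_cast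
      rw [it_succ]
      simp only [hL']; ring
  have hmaps : ∀ k : ℤ, MapsTo (S.it k) (Icc a b) (Icc a b) := fun k x hx => by
    constructor
    · simpa [S.it_fix h.fa] using (S.it_mono k).monotone hx.1
    · simpa [S.it_fix h.fb] using (S.it_mono k).monotone hx.2
  have hcomp : ∀ (q : ℝ → ℝ) (k : ℤ),
      eVariationOn (fun x => q (S.it k x)) (Icc a b) ≤ eVariationOn q (Icc a b) := fun q k =>
    eVariationOn.comp_le_of_monotoneOn q (S.it k) ((S.it_mono k).monotone.monotoneOn _) (hmaps k)
  set U := eVariationOn u (Icc a b)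
  have hbd : ∀ n : ℕ, eVariationOn (S.g n) (Icc a b) ≤ ENNReal.ofReal (ε / 2 * n) + (U + U) := by
    intro n
    have e : S.g n = fun x => ((∑ j ∈ Finset.range n, L' (S.it j x)) + u (S.it n x)) - u x :=
      funext (hg n)
    rw [e]
    refine (evar_sub _ _ _).trans ?_
    rw [← add_assoc]
    refine add_le_add_left ((evar_add _ _ _).trans (add_le_add ?_ (hcomp u n))) _
    refine (evar_sum _ _ n).trans ?_
    refine (Finset.sum_le_sum (s := Finset.range n) fun (j : ℕ) _ => (hcomp L' (j:ℤ)).trans vL').trans ?_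
    rw [Finset.sum_const, Finset.card_range, ← ENNReal.ofReal_nsmul, nsmul_eq_mul, mul_comm]
  have hev : ∀ᶠ n : ℕ in atTop, (U + U).toReal ≤ ε / 2 * n :=
    (tendsto_natCast_atTop_atTop.const_mul_atTop (by positivity : 0 < ε / 2)).eventually_ge_atTop _
  filter_upwards [hev] with n hn
  refine (hbd n).trans ?_
  have hUU : U + U ≠ ⊤ := ENNReal.add_ne_top.2 ⟨vu, vu⟩
  calc ENNReal.ofReal (ε / 2 * n) + (U + U)
      ≤ ENNReal.ofReal (ε / 2 * n) + ENNReal.ofReal (ε / 2 * n) := by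
        gcongr
        rw [← ENNReal.ofReal_toReal hUU]
        exact ENNReal.ofReal_le_ofReal hn
    _ = ENNReal.ofReal (ε * n) := by
        rw [← ENNReal.ofReal_add (by positivity) (by positivity)]; congr 1; ring

end Su

namespace Su
variable {S : Su}

variable (S) in
/-- conjugation by `x ↦ -x` -/
def refl : Su where
  f :=
    { toFun := fun x => - S.f (-x)
      invFun := fun x => - S.f.symm (-x)
      left_inv := fun x => by simp
      right_inv := fun x => by simp
      map_rel_iff' := by intro x y; simp }
  L := fun x => S.L (-x)
  W := fun x => - S.W (-x)
  hd := fun x => by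
    have h := ((S.hd (-x)).comp x (hasDerivAt_neg x)).neg
    simp only [mul_neg, mul_one, neg_neg] at h
    exact h
  Lc := S.Lc.comp continuous_neg
  Wc := (S.Wc.comp continuous_neg).neg
  Wm := fun x y h => neg_le_neg (S.Wm (neg_le_neg h))
  LW := fun x y h => by
    have := S.LW (-y) (-x) (neg_le_neg h)
    rw [abs_sub_comm]; linarith
  Lfix := fun x h => S.Lfix _ (by
    have h' : - S.f (-x) = x := h
    linarith)

lemma refl_f (x : ℝ) : S.refl.f x = - S.f (-x) := rfl
lemma refl_L (x : ℝ) : S.refl.L x = S.L (-x) := rfl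
lemma refl_W (x : ℝ) : S.refl.W x = - S.W (-x) := rfl

lemma refl_it (k : ℤ) (x : ℝ) : S.refl.it k x = - S.it k (-x) := by
  induction k using Int.induction_on generalizing x with
  | zero => simp
  | succ n ih => rw [it_succ, it_succ, ih, refl_f, neg_neg]
  | pred n ih =>
    apply S.refl.f.injective
    rw [← it_succ, refl_f, neg_neg, ← it_succ]
    simpa using ih x

lemma refl_g (n : ℕ) (x : ℝ) : S.refl.g n x = S.g n (-x) := by
  simp [g, refl_it, refl_L]

lemma neg_mem_Ioo {a b x : ℝ} (hx : x ∈ Ioo a b) : -x ∈ Ioo (-b) (-a) :=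
  ⟨neg_lt_neg hx.2, neg_lt_neg hx.1⟩
lemma neg_mem_Ioo' {a b x : ℝ} (hx : x ∈ Ioo (-b) (-a)) : -x ∈ Ioo a b :=
  ⟨by linarith [hx.2], by linarith [hx.1]⟩

lemma Cmp.refl_cmp {a b : ℝ} (h : S.Cmp a b) : S.refl.Cmp (-b) (-a) where
  ab := neg_lt_neg h.ab
  fa := by simp [refl_f, h.fb]
  fb := by simp [refl_f, h.fa]
  ne := fun x hx hf => h.ne (-x) (neg_mem_Ioo' hx) (by rw [refl_f] at hf; linarith)

lemma Cmp.inc_or {a b : ℝ} (h : S.Cmp a b) : S.Inc a b ∨ S.refl.Inc (-b) (-a) := by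
  by_cases h1 : ∀ x ∈ Ioo a b, x < S.f x
  · exact Or.inl ⟨h, h1⟩
  right
  push Not at h1
  obtain ⟨x, hx, hfx⟩ := h1
  refine ⟨h.refl_cmp, fun y hy => ?_⟩
  rw [refl_f]
  by_contra hc
  have hy' := neg_mem_Ioo' hy
  set z := -y with hz
  have hc' : z ≤ S.f z := by linarith
  have hcont : ContinuousOn (fun w => S.f w - w) (uIcc x z) :=
    (S.f.continuous.sub continuous_id).continuousOn
  have := intermediate_value_uIcc hcont
  have h0 : (0:ℝ) ∈ uIcc (S.f x - x) (S.f z - z) := by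
    rw [mem_uIcc]; left; constructor <;> linarith
  obtain ⟨w, hw, hw0⟩ := this h0
  exact h.ne w (ordConnected_Ioo.uIcc_subset hx hy' hw) (by simp only at hw0; linarith)

lemma Star.refl {a b : ℝ} (h : S.Star a b) : S.refl.Star (-b) (-a) := by
  intro x hx y hy
  have := h (-x) (neg_mem_Ioo' hx) (-y) (by
    rw [refl_f] at hy
    rw [mem_uIcc] at hy ⊢
    rcases hy with hy | hy
    · right; constructor <;> linarith [hy.1, hy.2]
    · left; constructor <;> linarith [hy.1, hy.2])
  simpa [refl_L, refl_it] using this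

lemma SmallVar.refl {a b : ℝ} (h : S.SmallVar a b) : S.refl.SmallVar (-b) (-a) := by
  intro ε hε
  filter_upwards [h ε hε] with n hn
  refine le_trans ?_ hn
  have e : S.refl.g n = S.g n ∘ fun x => -x := funext fun x => refl_g n x
  rw [e]
  refine eVariationOn.comp_le_of_antitoneOn _ _ (fun x _ y _ hxy => neg_le_neg hxy) ?_
  intro x hx
  exact ⟨by linarith [hx.2], by linarith [hx.1]⟩

lemma SmallVar.of_refl {a b : ℝ} (h : S.refl.SmallVar (-b) (-a)) : S.SmallVar a b := by
  intro ε hε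
  filter_upwards [h ε hε] with n hn
  refine le_trans ?_ hn
  have e : S.g n = S.refl.g n ∘ fun x => -x := funext fun x => by simp [refl_g]
  rw [e]
  refine eVariationOn.comp_le_of_antitoneOn _ _ (fun x _ y _ hxy => neg_le_neg hxy) ?_
  intro x hx
  exact ⟨by linarith [hx.2], by linarith [hx.1]⟩

lemma LF.of_refl {a b : ℝ} {φ ψ : ℝ → ℝ → ℝ} (h : S.refl.LF (-b) (-a) φ ψ) :
    S.LF a b (fun t x => - φ t (-x)) (fun t x => ψ t (-x)) where
  mem t x hx := neg_mem_Ioo' (h.mem t _ (neg_mem_Ioo hx))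
  zero x hx := by simp [h.zero _ (neg_mem_Ioo hx)]
  add t u x hx := by simp [h.add t u _ (neg_mem_Ioo hx)]
  one x hx := by simp [h.one _ (neg_mem_Ioo hx), refl_f]
  mono t x hx y hy hxy := neg_le_neg (h.mono t (neg_mem_Ioo hy) (neg_mem_Ioo hx) (neg_le_neg hxy))
  hd t x hx := by
    have := ((h.hd t _ (neg_mem_Ioo hx)).comp x (hasDerivAt_neg x)).neg
    simp only [mul_neg, mul_one, neg_neg] at this
    exact this
  psi_add t u x hx := by simp [h.psi_add t u _ (neg_mem_Ioo hx)]
  phic t x hx := by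
    have h1 := h.phic t _ (neg_mem_Ioo hx)
    have h2 : ContinuousAt (fun q : ℝ × ℝ => (q.1, -q.2)) (t, x) := by fun_prop
    exact (ContinuousAt.comp (f := fun q : ℝ × ℝ => (q.1, -q.2)) h1 h2).neg
  psic t x hx := by
    have h1 := h.psic t _ (neg_mem_Ioo hx)
    have h2 : ContinuousAt (fun q : ℝ × ℝ => (q.1, -q.2)) (t, x) := by fun_prop
    exact (ContinuousAt.comp (f := fun q : ℝ × ℝ => (q.1, -q.2)) h1 h2)
  btw t ht x hx := by
    have hy := h.btw t ht _ (neg_mem_Ioo hx)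
    rw [refl_f, neg_neg] at hy
    rw [mem_uIcc] at hy ⊢
    rcases hy with hy | hy
    · right; constructor <;> linarith [hy.1, hy.2]
    · left; constructor <;> linarith [hy.1, hy.2]
  bda t ht x hx := by
    have := h.bdb t ht _ (neg_mem_Ioo hx)
    simp only [refl_W, refl_f, neg_neg, neg_sub_neg] at this
    rwa [abs_sub_comm (S.W a), abs_sub_comm (S.W a)] at this
  bdb t ht x hx := by
    have := h.bda t ht _ (neg_mem_Ioo hx)
    simp only [refl_W, refl_f, neg_neg, neg_sub_neg] at this
    rwa [abs_sub_comm (S.W b), abs_sub_comm (S.W b)] at this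

lemma Cmp.exists_LF {a b : ℝ} (h : S.Cmp a b) (hv : S.SmallVar a b) : ∃ φ ψ, S.LF a b φ ψ := by
  rcases h.inc_or with hi | hi
  · exact hi.exists_LF (hi.star_of_smallVar hv)
  · obtain ⟨φ, ψ, hl⟩ := hi.exists_LF (hi.star_of_smallVar hv.refl)
    exact ⟨_, _, hl.of_refl⟩

lemma Cmp.smallVar_of_star {a b : ℝ} (h : S.Cmp a b) (hv : S.Star a b) : S.SmallVar a b := by
  rcases h.inc_or with hi | hi
  · exact hi.smallVar_of_star hv
  · exact (hi.smallVar_of_star hv.refl).of_refl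

lemma Cmp.tendsto_it {a b : ℝ} (h : S.Cmp a b) {x : ℝ} (hx : x ∈ Ioo a b) :
    (∃ p, S.f p = p ∧ p ∈ Icc a b ∧ Tendsto (fun n : ℕ => S.it n x) atTop (𝓝 p)) ∧
    (∃ p, S.f p = p ∧ p ∈ Icc a b ∧ Tendsto (fun n : ℕ => S.it (-n) x) atTop (𝓝 p)) := by
  rcases h.inc_or with hi | hi
  · exact ⟨⟨b, h.fb, right_mem_Icc.2 h.ab.le, hi.tendsto_fwd hx⟩, ⟨a, h.fa, left_mem_Icc.2 h.ab.le, hi.tendsto_bwd hx⟩⟩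
  · have h1 := (hi.tendsto_fwd (neg_mem_Ioo hx)).neg
    have h2 := (hi.tendsto_bwd (neg_mem_Ioo hx)).neg
    simp only [refl_it, neg_neg] at h1 h2
    exact ⟨⟨a, h.fa, left_mem_Icc.2 h.ab.le, h1⟩, ⟨b, h.fb, right_mem_Icc.2 h.ab.le, h2⟩⟩

lemma Cmp.summable_L {a b : ℝ} (h : S.Cmp a b) {x y : ℝ} (hx : x ∈ Ioo a b)
    (hy : y ∈ Ioo a b) :
    Summable (fun j : ℕ => S.L (S.it j y) - S.L (S.it j x)) ∧
    Summable (fun j : ℕ => S.L (S.it (-(j + 1)) y) - S.L (S.it (-(j + 1)) x)) := by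
  rcases h.inc_or with hi | hi
  · exact ⟨hi.summable_L_fwd hx hy, hi.summable_L_bwd hx hy⟩
  · have h1 := hi.summable_L_fwd (neg_mem_Ioo hx) (neg_mem_Ioo hy)
    have h2 := hi.summable_L_bwd (neg_mem_Ioo hx) (neg_mem_Ioo hy)
    simp only [refl_it, refl_L, neg_neg] at h1 h2
    exact ⟨h1, h2⟩

end Su

namespace Su
variable {S : Su}

variable (S) in
/-- `f` is supported in `[0,1]` -/
def Out : Prop := ∀ x, x ∉ Ioo (0:ℝ) 1 → S.f x = x

lemma fix_closed : IsClosed {x | S.f x = x} := isClosed_eq S.f.continuous continuous_id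

lemma exists_last {x y : ℝ} (h : ∃ p ∈ Icc x y, S.f p = p) :
    ∃ p ∈ Icc x y, S.f p = p ∧ ∀ q ∈ Icc x y, S.f q = q → q ≤ p := by
  obtain ⟨p0, hp0, hf0⟩ := h
  obtain ⟨p, ⟨hp, hpf⟩, hl⟩ := (isCompact_Icc.inter_right (fix_closed (S := S))).exists_isGreatest
    (s := Icc x y ∩ {x | S.f x = x}) ⟨p0, hp0, hf0⟩
  exact ⟨p, hp, hpf, fun q hq hqf => hl ⟨hq, hqf⟩⟩

lemma exists_first {x y : ℝ} (h : ∃ p ∈ Icc x y, S.f p = p) :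
    ∃ p ∈ Icc x y, S.f p = p ∧ ∀ q ∈ Icc x y, S.f q = q → p ≤ q := by
  obtain ⟨p0, hp0, hf0⟩ := h
  obtain ⟨p, ⟨hp, hpf⟩, hl⟩ := (isCompact_Icc.inter_right (fix_closed (S := S))).exists_isLeast
    (s := Icc x y ∩ {x | S.f x = x}) ⟨p0, hp0, hf0⟩
  exact ⟨p, hp, hpf, fun q hq hqf => hl ⟨hq, hqf⟩⟩

lemma Out.exists_cmp (ho : S.Out) {x : ℝ} (hx : S.f x ≠ x) :
    ∃ a b, S.Cmp a b ∧ x ∈ Ioo a b := by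
  have hx01 : x ∈ Ioo (0:ℝ) 1 := by
    by_contra hc; exact hx (ho x hc)
  obtain ⟨a, ha, haf, hal⟩ := exists_last (S := S) (x := 0) (y := x)
    ⟨0, left_mem_Icc.2 hx01.1.le, ho 0 (by simp)⟩
  obtain ⟨b, hb, hbf, hbl⟩ := exists_first (S := S) (x := x) (y := 1)
    ⟨1, right_mem_Icc.2 hx01.2.le, ho 1 (by simp)⟩
  have hax : a < x := lt_of_le_of_ne ha.2 (by rintro rfl; exact hx haf)
  have hxb : x < b := lt_of_le_of_ne hb.1 (by rintro rfl; exact hx hbf)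
  refine ⟨a, b, ⟨hax.trans hxb, haf, hbf, fun y hy hyf => ?_⟩, hax, hxb⟩
  rcases le_total y x with h | h
  · exact absurd (hal y ⟨ha.1.trans hy.1.le, h⟩ hyf) (not_le.2 hy.1)
  · exact absurd (hbl y ⟨h, hy.2.le.trans hb.2⟩ hyf) (not_le.2 hy.2)

lemma Cmp.le_of_fix {a b p x : ℝ} (h : S.Cmp a b) (hx : x ∈ Ioo a b) (hp : S.f p = p)
    (hpx : p ≤ x) : p ≤ a := by
  by_contra hc
  exact h.ne p ⟨not_le.1 hc, hpx.trans_lt hx.2⟩ hp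

lemma Cmp.ge_of_fix {a b p x : ℝ} (h : S.Cmp a b) (hx : x ∈ Ioo a b) (hp : S.f p = p)
    (hpx : x ≤ p) : b ≤ p := by
  by_contra hc
  exact h.ne p ⟨hx.1.trans_le hpx, not_le.1 hc⟩ hp

lemma Cmp.unique {a b a' b' x : ℝ} (h : S.Cmp a b) (h' : S.Cmp a' b') (hx : x ∈ Ioo a b)
    (hx' : x ∈ Ioo a' b') : a = a' ∧ b = b' :=
  ⟨le_antisymm (h'.le_of_fix hx' h.fa hx.1.le) (h.le_of_fix hx h'.fa hx'.1.le),
   le_antisymm (h.ge_of_fix hx h'.fb hx'.2.le) (h'.ge_of_fix hx' h.fb hx.2.le)⟩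

lemma LF.congr {a b : ℝ} {φ ψ φ' ψ' : ℝ → ℝ → ℝ} (h : S.LF a b φ ψ)
    (h1 : ∀ t, ∀ x ∈ Ioo a b, φ' t x = φ t x) (h2 : ∀ t, ∀ x ∈ Ioo a b, ψ' t x = ψ t x) :
    S.LF a b φ' ψ' where
  mem t x hx := by rw [h1 t x hx]; exact h.mem t x hx
  zero x hx := by rw [h1 _ x hx]; exact h.zero x hx
  add t u x hx := by rw [h1 _ x hx, h1 u x hx, h1 t _ (h.mem u x hx)]; exact h.add t u x hx
  one x hx := by rw [h1 _ x hx]; exact h.one x hx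
  mono t x hx y hy hxy := by rw [h1 t x hx, h1 t y hy]; exact h.mono t hx hy hxy
  hd t x hx := by
    rw [h2 t x hx]
    refine (h.hd t x hx).congr_of_eventuallyEq ?_
    filter_upwards [isOpen_Ioo.mem_nhds hx] with y hy using h1 t y hy
  psi_add t u x hx := by
    rw [h2 _ x hx, h1 u x hx, h2 t _ (h.mem u x hx), h2 u x hx]; exact h.psi_add t u x hx
  phic t x hx := by
    refine (h.phic t x hx).congr ?_
    have := (isOpen_univ.prod isOpen_Ioo).mem_nhds (show (t, x) ∈ (univ : Set ℝ) ×ˢ Ioo a b from ⟨trivial, hx⟩)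
    filter_upwards [this] with y hy using (h1 _ _ hy.2).symm
  psic t x hx := by
    refine (h.psic t x hx).congr ?_
    have := (isOpen_univ.prod isOpen_Ioo).mem_nhds (show (t, x) ∈ (univ : Set ℝ) ×ˢ Ioo a b from ⟨trivial, hx⟩)
    filter_upwards [this] with y hy using (h2 _ _ hy.2).symm
  btw t ht x hx := by rw [h1 _ x hx]; exact h.btw t ht x hx
  bda t ht x hx := by rw [h2 _ x hx]; exact h.bda t ht x hx
  bdb t ht x hx := by rw [h2 _ x hx]; exact h.bdb t ht x hx

variable (S) in
structure GF (Φ Ψ : ℝ → ℝ → ℝ) : Prop where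
  out : S.Out
  fix : ∀ t p, S.f p = p → Φ t p = p
  fixp : ∀ t p, S.f p = p → Ψ t p = 0
  lf : ∀ a b, S.Cmp a b → S.LF a b Φ Ψ

lemma Out.exists_GF (ho : S.Out) (hv : ∀ a b, S.Cmp a b → S.SmallVar a b) :
    ∃ Φ Ψ, S.GF Φ Ψ := by
  classical
  have h1 : ∀ a b, ∃ φ ψ, S.Cmp a b → S.LF a b φ ψ := fun a b => by
    by_cases h : S.Cmp a b
    · obtain ⟨φ, ψ, hl⟩ := h.exists_LF (hv a b h)
      exact ⟨φ, ψ, fun _ => hl⟩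
    · exact ⟨fun _ x => x, fun _ x => x, fun h' => absurd h' h⟩
  have h2 : ∀ x, ∃ a b, S.f x ≠ x → S.Cmp a b ∧ x ∈ Ioo a b := fun x => by
    by_cases h : S.f x = x
    · exact ⟨0, 0, fun h' => absurd h h'⟩
    · obtain ⟨a, b, hab⟩ := ho.exists_cmp h
      exact ⟨a, b, fun _ => hab⟩
  choose φ ψ hφ using h1
  choose A B hAB using h2
  refine ⟨fun t x => if S.f x = x then x else φ (A x) (B x) t x,
    fun t x => if S.f x = x then 0 else ψ (A x) (B x) t x, ho, fun t p hp => by simp [hp],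
    fun t p hp => by simp [hp], fun a b hab => ?_⟩
  refine (hφ a b hab).congr (fun t x hx => ?_) (fun t x hx => ?_)
  all_goals
    have hn := hab.ne x hx
    obtain ⟨e1, e2⟩ := (hAB x hn).1.unique hab (hAB x hn).2 hx
    simp only [if_neg hn, e1, e2]

namespace GF
variable {Φ Ψ : ℝ → ℝ → ℝ}

lemma zero (h : S.GF Φ Ψ) (x : ℝ) : Φ 0 x = x := by
  by_cases hx : S.f x = x
  · exact h.fix _ _ hx
  · obtain ⟨a, b, hc, hm⟩ := h.out.exists_cmp hx
    exact (h.lf a b hc).zero x hm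

lemma one (h : S.GF Φ Ψ) (x : ℝ) : Φ 1 x = S.f x := by
  by_cases hx : S.f x = x
  · rw [h.fix _ _ hx, hx]
  · obtain ⟨a, b, hc, hm⟩ := h.out.exists_cmp hx
    exact (h.lf a b hc).one x hm

lemma add (h : S.GF Φ Ψ) (t u x : ℝ) : Φ (t + u) x = Φ t (Φ u x) := by
  by_cases hx : S.f x = x
  · simp only [h.fix _ _ hx]
  · obtain ⟨a, b, hc, hm⟩ := h.out.exists_cmp hx
    exact (h.lf a b hc).add t u x hm

lemma psi_add (h : S.GF Φ Ψ) (t u x : ℝ) : Ψ (t + u) x = Ψ t (Φ u x) + Ψ u x := by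
  by_cases hx : S.f x = x
  · simp only [h.fix _ _ hx, h.fixp _ _ hx, add_zero]
  · obtain ⟨a, b, hc, hm⟩ := h.out.exists_cmp hx
    exact (h.lf a b hc).psi_add t u x hm

lemma btw (h : S.GF Φ Ψ) {t : ℝ} (ht : t ∈ Icc (0:ℝ) 1) (x : ℝ) : Φ t x ∈ uIcc x (S.f x) := by
  by_cases hx : S.f x = x
  · rw [h.fix _ _ hx]; exact left_mem_uIcc
  · obtain ⟨a, b, hc, hm⟩ := h.out.exists_cmp hx
    exact (h.lf a b hc).btw t ht x hm

lemma ge_fix (h : S.GF Φ Ψ) (t : ℝ) {p x : ℝ} (hp : S.f p = p) (hpx : p ≤ x) : p ≤ Φ t x := by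
  by_cases hx : S.f x = x
  · rwa [h.fix _ _ hx]
  · obtain ⟨a, b, hc, hm⟩ := h.out.exists_cmp hx
    exact (hc.le_of_fix hm hp hpx).trans ((h.lf a b hc).mem t x hm).1.le

lemma le_fix (h : S.GF Φ Ψ) (t : ℝ) {p x : ℝ} (hp : S.f p = p) (hpx : x ≤ p) : Φ t x ≤ p := by
  by_cases hx : S.f x = x
  · rwa [h.fix _ _ hx]
  · obtain ⟨a, b, hc, hm⟩ := h.out.exists_cmp hx
    exact ((h.lf a b hc).mem t x hm).2.le.trans (hc.ge_of_fix hm hp hpx)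

lemma mono (h : S.GF Φ Ψ) (t : ℝ) : Monotone (Φ t) := by
  intro x y hxy
  by_cases hp : ∃ p ∈ Icc x y, S.f p = p
  · obtain ⟨p, hp, hf⟩ := hp
    exact (h.le_fix t hf hp.1).trans (h.ge_fix t hf hp.2)
  · push Not at hp
    obtain ⟨a, b, hc, hm⟩ := h.out.exists_cmp (hp x (left_mem_Icc.2 hxy))
    have hy : y < b := by
      by_contra hc'
      exact hp b ⟨hm.2.le, not_lt.1 hc'⟩ hc.fb
    exact (h.lf a b hc).mono t hm ⟨hm.1.trans_le hxy, hy⟩ hxy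

lemma neg_cancel (h : S.GF Φ Ψ) (t x : ℝ) : Φ t (Φ (-t) x) = x := by
  rw [← h.add, add_neg_cancel, h.zero]
lemma neg_cancel' (h : S.GF Φ Ψ) (t x : ℝ) : Φ (-t) (Φ t x) = x := by
  rw [← h.add, neg_add_cancel, h.zero]

lemma bij (h : S.GF Φ Ψ) (t : ℝ) : Function.Bijective (Φ t) :=
  ⟨Function.LeftInverse.injective (h.neg_cancel' t), Function.RightInverse.surjective (h.neg_cancel t)⟩

lemma cont (h : S.GF Φ Ψ) (t : ℝ) : Continuous (Φ t) :=
  (h.mono t).continuous_of_surjective (h.bij t).2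

lemma bound (h : S.GF Φ Ψ) {t : ℝ} (ht : t ∈ Icc (0:ℝ) 1) {p : ℝ} (hp : S.f p = p) (x : ℝ) :
    |Ψ t x| ≤ |S.W x - S.W p| + |S.W (S.f x) - S.W p| := by
  by_cases hx : S.f x = x
  · rw [h.fixp _ _ hx, abs_zero]; positivity
  · obtain ⟨a, b, hc, hm⟩ := h.out.exists_cmp hx
    have hm' := hc.f_mem hm
    rcases le_total p x with hpx | hpx
    · have hpa := S.Wm (hc.le_of_fix hm hp hpx)
      refine ((h.lf a b hc).bda t ht x hm).trans (add_le_add ?_ ?_)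
      · have := S.Wm hm.1.le
        rw [abs_of_nonneg (by linarith), abs_of_nonneg (by linarith)]; linarith
      · have := S.Wm hm'.1.le
        rw [abs_of_nonneg (by linarith), abs_of_nonneg (by linarith)]; linarith
    · have hpa := S.Wm (hc.ge_of_fix hm hp hpx)
      refine ((h.lf a b hc).bdb t ht x hm).trans (add_le_add ?_ ?_)
      · have := S.Wm hm.2.le
        rw [abs_of_nonpos (by linarith), abs_of_nonpos (by linarith)]; linarith
      · have := S.Wm hm'.2.le
        rw [abs_of_nonpos (by linarith), abs_of_nonpos (by linarith)]; linarith

lemma small (h : S.GF Φ Ψ) {p : ℝ} (hp : S.f p = p) (k : ℤ) : ∀ ε > (0:ℝ),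
    ∀ᶠ x in 𝓝 p, ∀ t ∈ Icc (k:ℝ) (k + 1), |Ψ t x| < ε := by
  have base : ∀ ε > (0:ℝ), ∀ᶠ x in 𝓝 p, ∀ t ∈ Icc (0:ℝ) 1, |Ψ t x| < ε := by
    intro ε hε
    have hc : Continuous fun x => |S.W x - S.W p| + |S.W (S.f x) - S.W p| := by
      have := S.Wc; have := S.f.continuous; fun_prop
    have := (hc.tendsto p).eventually (gt_mem_nhds (show _ < ε by simpa [hp] using hε))
    filter_upwards [this] with x hx t ht
    exact (h.bound ht hp x).trans_lt hx
  have tp : ∀ t, Tendsto (Φ t) (𝓝 p) (𝓝 p) := fun t => by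
    simpa [h.fix t p hp] using (h.cont t).tendsto p
  induction k using Int.induction_on with
  | zero => simpa using base
  | succ n ih =>
    intro ε hε
    filter_upwards [(tp 1).eventually (ih (ε/2) (by positivity)), base (ε/2) (by positivity)]
      with x h1 h2 t ht
    have e := h.psi_add (t - 1) 1 x
    rw [sub_add_cancel] at e
    rw [e]
    refine (abs_add_le _ _).trans_lt ?_
    have a1 := h1 (t - 1) (by push_cast at ht ⊢; constructor <;> linarith [ht.1, ht.2])
    have a2 := h2 1 (by simp)
    linarith
  | pred n ih =>
    intro ε hε
    filter_upwards [(tp (-1)).eventually (ih (ε/2) (by positivity)),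
      (tp (-1)).eventually (base (ε/2) (by positivity))] with x h1 h2 t ht
    have e := h.psi_add (t + 1) (-1) x
    rw [add_neg_cancel_right] at e
    have e2 := h.psi_add 1 (-1) x
    have e3 := h.psi_add 0 0 x
    rw [add_neg_cancel] at e2
    rw [h.zero, add_zero] at e3
    rw [show Ψ t x = Ψ (t + 1) (Φ (-1) x) - Ψ 1 (Φ (-1) x) by linarith]
    refine (abs_sub _ _).trans_lt ?_
    have a1 := h1 (t + 1) (by push_cast at ht ⊢; constructor <;> linarith [ht.1, ht.2])
    have a2 := h2 1 (by simp)
    linarith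

lemma psic (h : S.GF Φ Ψ) (t x : ℝ) : ContinuousAt (Function.uncurry Ψ) (t, x) := by
  by_cases hx : S.f x = x
  · rw [Metric.continuousAt_iff']
    intro ε hε
    have h1 := h.small hx ⌊t⌋ ε hε
    have h2 := h.small hx (⌊t⌋ - 1) ε hε
    have ht : ∀ᶠ s in 𝓝 t, s ∈ Ioo ((⌊t⌋:ℝ) - 1) (⌊t⌋ + 1) :=
      Ioo_mem_nhds (by linarith [Int.floor_le t]) (Int.lt_floor_add_one t)
    rw [nhds_prod_eq]
    filter_upwards [ht.prod_mk (h1.and h2)] with ⟨s, y⟩ ⟨hs, hy1, hy2⟩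
    simp only [Function.uncurry, h.fixp _ _ hx, dist_zero_right, Real.norm_eq_abs]
    simp only at hs hy1 hy2
    rcases le_total (⌊t⌋ : ℝ) s with hle | hle
    · exact hy1 s ⟨hle, hs.2.le⟩
    · exact hy2 s (by push_cast; exact ⟨hs.1.le, by linarith⟩)
  · obtain ⟨a, b, hc, hm⟩ := h.out.exists_cmp hx
    exact (h.lf a b hc).psic t x hm

lemma phic (h : S.GF Φ Ψ) (t x : ℝ) : ContinuousAt (Function.uncurry Φ) (t, x) := by
  by_cases hx : S.f x = x
  · rw [Metric.continuousAt_iff']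
    intro ε hε
    have key : ∀ k : ℤ, ∀ᶠ y in 𝓝 x, ∀ s ∈ Icc (k:ℝ) (k + 1), Φ s y ∈ Ioo (x - ε) (x + ε) := by
      intro k
      have n1 : Ioo (x - ε) (x + ε) ∈ 𝓝 x := Ioo_mem_nhds (by linarith) (by linarith)
      have t1 : Tendsto (Φ k) (𝓝 x) (𝓝 x) := by
        simpa [h.fix k x hx] using (h.cont k).tendsto x
      have t2 : Tendsto (fun y => S.f (Φ k y)) (𝓝 x) (𝓝 x) := by
        have := (S.f.continuous.tendsto x).comp t1
        rwa [hx] at this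
      filter_upwards [t1 n1, t2 n1] with y h1 h2 s hs
      have e := h.add (s - k) k y
      rw [sub_add_cancel] at e
      rw [e]
      exact ordConnected_Ioo.uIcc_subset h1 h2
        (h.btw ⟨by linarith [hs.1], by linarith [hs.2]⟩ _)
    have h1 := key ⌊t⌋
    have h2 := key (⌊t⌋ - 1)
    have ht : ∀ᶠ s in 𝓝 t, s ∈ Ioo ((⌊t⌋:ℝ) - 1) (⌊t⌋ + 1) :=
      Ioo_mem_nhds (by linarith [Int.floor_le t]) (Int.lt_floor_add_one t)
    rw [nhds_prod_eq]
    filter_upwards [ht.prod_mk (h1.and h2)] with ⟨s, y⟩ ⟨hs, hy1, hy2⟩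
    simp only [Function.uncurry, h.fix _ _ hx, Real.dist_eq]
    simp only at hs hy1 hy2
    have : Φ s y ∈ Ioo (x - ε) (x + ε) := by
      rcases le_total (⌊t⌋ : ℝ) s with hle | hle
      · exact hy1 s ⟨hle, hs.2.le⟩
      · exact hy2 s (by push_cast; exact ⟨hs.1.le, by linarith⟩)
    rw [abs_lt]; constructor <;> linarith [this.1, this.2]
  · obtain ⟨a, b, hc, hm⟩ := h.out.exists_cmp hx
    exact (h.lf a b hc).phic t x hm

lemma hd (h : S.GF Φ Ψ) (t x : ℝ) : HasDerivAt (Φ t) (Real.exp (Ψ t x)) x := by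
  by_cases hx : S.f x = x
  · rw [h.fixp _ _ hx, Real.exp_zero, hasDerivAt_iff_isLittleO, Asymptotics.isLittleO_iff]
    intro ε hε
    have hc : ContinuousAt (fun y => Real.exp (Ψ t y) - 1) x := by
      have h1 : ContinuousAt (fun y => Ψ t y) x :=
        ContinuousAt.comp (f := fun y : ℝ => (t, y)) (h.psic t x) (by fun_prop)
      exact h1.rexp.sub continuousAt_const
    rw [Metric.continuousAt_iff'] at hc
    obtain ⟨δ, hδ, hb⟩ := Metric.eventually_nhds_iff_ball.1 (hc ε hε)
    filter_upwards [Metric.ball_mem_nhds x hδ] with y hy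
    rw [h.fix _ _ hx]
    simp only [smul_eq_mul, mul_one, Real.norm_eq_abs]
    have hb' : ∀ z ∈ uIcc x y, |Real.exp (Ψ t z) - 1| < ε := fun z hz => by
      have hz' : z ∈ Metric.ball x δ :=
        (convex_ball x δ).ordConnected.uIcc_subset (Metric.mem_ball_self hδ) hy hz
      simpa [h.fixp _ _ hx, Real.dist_eq] using hb z hz'
    rw [show Φ t y - x - (y - x) = Φ t y - y by ring]
    by_cases hyf : S.f y = y
    · rw [h.fix _ _ hyf, sub_self, abs_zero]; positivity
    obtain ⟨a, b, hcm, hm⟩ := h.out.exists_cmp hyf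
    have hcc : Continuous fun z => Φ t z - z := (h.cont t).sub continuous_id
    have hdd : ∀ z ∈ Ioo a b, HasDerivAt (fun z => Φ t z - z) (Real.exp (Ψ t z) - 1) z :=
      fun z hz => ((h.lf a b hcm).hd t z hz).sub (hasDerivAt_id z)
    rcases le_total x y with hxy | hxy
    · have hxa := hcm.le_of_fix hm hx hxy
      obtain ⟨c, hc, he⟩ := exists_hasDerivAt_eq_slope (fun z => Φ t z - z)
        (fun z => Real.exp (Ψ t z) - 1) hm.1 hcc.continuousOn
        (fun z hz => hdd z ⟨hz.1, hz.2.trans hm.2⟩)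
      have h3 := hb' c (by rw [uIcc_of_le hxy]; exact ⟨hxa.trans hc.1.le, hc.2.le⟩)
      have hya : 0 < y - a := sub_pos.2 hm.1
      rw [he, h.fix _ _ hcm.fa, sub_self, sub_zero, abs_div, abs_of_pos hya, div_lt_iff₀ hya] at h3
      refine h3.le.trans ?_
      rw [abs_of_nonneg (sub_nonneg.2 hxy)]
      gcongr
    · have hxa := hcm.ge_of_fix hm hx hxy
      obtain ⟨c, hc, he⟩ := exists_hasDerivAt_eq_slope (fun z => Φ t z - z)
        (fun z => Real.exp (Ψ t z) - 1) hm.2 hcc.continuousOn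
        (fun z hz => hdd z ⟨hm.1.trans hz.1, hz.2⟩)
      have h3 := hb' c (by rw [uIcc_of_ge hxy]; exact ⟨hc.1.le, hc.2.le.trans hxa⟩)
      have hya : 0 < b - y := sub_pos.2 hm.2
      rw [he, h.fix _ _ hcm.fb, sub_self, zero_sub, abs_div, abs_neg, abs_of_pos hya,
        div_lt_iff₀ hya] at h3
      refine h3.le.trans ?_
      rw [abs_sub_comm, abs_of_nonneg (sub_nonneg.2 hxy)]
      gcongr
  · obtain ⟨a, b, hc, hm⟩ := h.out.exists_cmp hx
    exact (h.lf a b hc).hd t x hm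

lemma psi_cont (h : S.GF Φ Ψ) (t : ℝ) : Continuous (Ψ t) :=
  continuous_iff_continuousAt.2 fun x =>
    ContinuousAt.comp (f := fun y : ℝ => (t, y)) (h.psic t x) (by fun_prop)

lemma c1 (h : S.GF Φ Ψ) (t₀ : ℝ) {K : Set ℝ} (hK : IsCompact K) {ε : ℝ} (hε : 0 < ε) :
    ∃ δ > (0:ℝ), ∀ t : ℝ, |t - t₀| < δ → ∀ x ∈ K, |Φ t x - Φ t₀ x| + |Ψ t x - Ψ t₀ x| < ε := by
  have h1 : Continuous (Function.uncurry Φ) := continuous_iff_continuousAt.2 fun ⟨t, x⟩ => h.phic t x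
  have h2 : Continuous (Function.uncurry Ψ) := continuous_iff_continuousAt.2 fun ⟨t, x⟩ => h.psic t x
  have hcont : Continuous fun q : ℝ × ℝ => |Φ q.1 q.2 - Φ t₀ q.2| + |Ψ q.1 q.2 - Ψ t₀ q.2| := by
    have a1 : Continuous fun q : ℝ × ℝ => Φ q.1 q.2 := h1
    have a2 : Continuous fun q : ℝ × ℝ => Ψ q.1 q.2 := h2
    have a3 : Continuous fun q : ℝ × ℝ => Φ t₀ q.2 := (h.cont t₀).comp continuous_snd
    have a4 : Continuous fun q : ℝ × ℝ => Ψ t₀ q.2 := (h.psi_cont t₀).comp continuous_snd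
    fun_prop
  have := hK.eventually_forall_of_forall_eventually (x₀ := t₀)
    (P := fun t x => |Φ t x - Φ t₀ x| + |Ψ t x - Ψ t₀ x| < ε) (fun x _ => by
      exact (hcont.tendsto (t₀, x)).eventually (gt_mem_nhds (by simpa using hε)))
  obtain ⟨δ, hδ, hb⟩ := Metric.eventually_nhds_iff.1 this
  exact ⟨δ, hδ, fun t ht x hx => hb (by rwa [Real.dist_eq]) x hx⟩

end GF
end Su

namespace Su
variable {S : Su}

lemma Cmp.sub01 {a b : ℝ} (h : S.Cmp a b) (ho : S.Out) : 0 ≤ a ∧ b ≤ 1 := by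
  constructor
  · by_contra hc
    push Not at hc
    obtain ⟨x, hx1, hx2⟩ := exists_between (lt_min h.ab hc)
    exact h.ne x ⟨hx1, hx2.trans_le (min_le_left _ _)⟩
      (ho x fun h' => absurd (hx2.trans_le (min_le_right _ _)) (not_lt.2 h'.1.le))
  · by_contra hc
    push Not at hc
    obtain ⟨x, hx1, hx2⟩ := exists_between (max_lt h.ab hc)
    exact h.ne x ⟨(le_max_left _ _).trans_lt hx1, hx2⟩
      (ho x fun h' => absurd ((le_max_right _ _).trans_lt hx1) (not_lt.2 h'.2.le))

variable (S) in
/-- a `C¹` flow on `[0,1]` with time one map `f` -/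
structure Fl (Φ Φ' : ℝ → ℝ → ℝ) : Prop where
  out : S.Out
  zero : ∀ x : ℝ, Φ 0 x = x
  add : ∀ t u : ℝ, ∀ x : ℝ, Φ (t + u) x = Φ t (Φ u x)
  maps : ∀ t, MapsTo (Φ t) (Icc 0 1) (Icc 0 1)
  hd : ∀ t : ℝ, ∀ x ∈ Icc (0:ℝ) 1, HasDerivWithinAt (Φ t) (Φ' t x) (Icc 0 1) x
  dc : ∀ t : ℝ, ContinuousOn (Φ' t) (Icc 0 1)
  pos : ∀ t : ℝ, ∀ x ∈ Icc (0:ℝ) 1, 0 < Φ' t x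
  c1 : ∀ t₀ : ℝ, ∀ ε > (0:ℝ), ∃ δ > (0:ℝ), ∀ t : ℝ,
    |t - t₀| < δ → ∀ x ∈ Icc (0:ℝ) 1,
      |Φ t x - Φ t₀ x| + |Real.log (Φ' t x) - Real.log (Φ' t₀ x)| < ε
  one : ∀ x, Φ 1 x = S.f x

namespace Fl
variable {Φ Φ' : ℝ → ℝ → ℝ}

lemma tc (h : S.Fl Φ Φ') {x : ℝ} (hx : x ∈ Icc (0:ℝ) 1) : Continuous fun t => Φ t x := by
  rw [Metric.continuous_iff]
  intro t ε hε
  obtain ⟨δ, hδ, hb⟩ := h.c1 t ε hε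
  refine ⟨δ, hδ, fun s hs => ?_⟩
  have := hb s hs x hx
  rw [Real.dist_eq]
  linarith [abs_nonneg (Real.log (Φ' s x) - Real.log (Φ' t x))]

lemma kc (h : S.Fl Φ Φ') {x : ℝ} (hx : x ∈ Icc (0:ℝ) 1) :
    Continuous fun t => Real.log (Φ' t x) := by
  rw [Metric.continuous_iff]
  intro t ε hε
  obtain ⟨δ, hδ, hb⟩ := h.c1 t ε hε
  refine ⟨δ, hδ, fun s hs => ?_⟩
  have := hb s hs x hx
  rw [Real.dist_eq]
  linarith [abs_nonneg (Φ s x - Φ t x)]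

lemma coc (h : S.Fl Φ Φ') (t u : ℝ) {x : ℝ} (hx : x ∈ Icc (0:ℝ) 1) :
    Real.log (Φ' (t + u) x) = Real.log (Φ' t (Φ u x)) + Real.log (Φ' u x) := by
  have h1 := h.hd (t + u) x hx
  have h2 := (h.hd t _ (h.maps u hx)).comp x (h.hd u x hx) (h.maps u)
  have e : Φ (t + u) = Φ t ∘ Φ u := funext fun z => h.add t u z
  rw [e] at h1
  rw [((uniqueDiffOn_Icc zero_lt_one) x hx).eq_deriv _ h1 h2,
    Real.log_mul (h.pos _ _ (h.maps u hx)).ne' (h.pos _ _ hx).ne']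

lemma log_one (h : S.Fl Φ Φ') {x : ℝ} (hx : x ∈ Icc (0:ℝ) 1) : Real.log (Φ' 1 x) = S.L x := by
  have h1 := h.hd 1 x hx
  have e : Φ 1 = S.f := funext fun z => h.one z
  rw [e] at h1
  rw [((uniqueDiffOn_Icc zero_lt_one) x hx).eq_deriv _ h1 (S.hd x).hasDerivWithinAt, Real.log_exp]

lemma mono (h : S.Fl Φ Φ') (t : ℝ) : MonotoneOn (Φ t) (Icc 0 1) := by
  refine (strictMonoOn_of_hasDerivWithinAt_pos (f' := Φ' t) (convex_Icc 0 1)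
    (fun x hx => (h.hd t x hx).continuousWithinAt) (fun x hx => ?_) (fun x hx => ?_)).monotoneOn
  · exact (h.hd t x (interior_subset hx)).mono interior_subset
  · exact h.pos t x (interior_subset hx)

lemma fix (h : S.Fl Φ Φ') {p : ℝ} (hp01 : p ∈ Icc (0:ℝ) 1) (hp : S.f p = p) (t : ℝ) :
    Φ t p = p := by
  have hper : Function.Periodic (fun s => Φ s p) 1 := fun s => by
    simp only; rw [h.add, h.one, hp]
  obtain ⟨s, -, hs⟩ := isCompact_Icc.exists_isMaxOn (nonempty_Icc.2 zero_le_one)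
    (h.tc hp01).continuousOn (s := Icc (0:ℝ) 1)
  have hmax : ∀ u, Φ u p ≤ Φ s p := fun u => by
    obtain ⟨v, hv, e⟩ := hper.exists_mem_Ico₀ zero_lt_one u
    rw [e]; exact hs (Ico_subset_Icc_self hv)
  have hM : Φ s p ∈ Icc (0:ℝ) 1 := h.maps s hp01
  have hfix : ∀ u, Φ u (Φ s p) = Φ s p := fun u => by
    refine le_antisymm (by rw [← h.add]; exact hmax _) ?_
    have h1 : Φ (-u) (Φ s p) ≤ Φ s p := by rw [← h.add]; exact hmax _
    have h2 := h.mono u (h.maps _ hM) hM h1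
    rwa [← h.add, add_neg_cancel, h.zero] at h2
  have e1 := hfix (-s)
  rw [← h.add, neg_add_cancel, h.zero] at e1
  have := hfix t
  rwa [← e1] at this

lemma fixlog (h : S.Fl Φ Φ') {p : ℝ} (hp01 : p ∈ Icc (0:ℝ) 1) (hp : S.f p = p) (t : ℝ) :
    Real.log (Φ' t p) = 0 := by
  let F : ℝ →+ ℝ := AddMonoidHom.mk' (fun t => Real.log (Φ' t p)) fun t u => by
    rw [h.coc t u hp01, h.fix hp01 hp]
  have := map_real_smul F (h.kc hp01) t 1
  simp only [smul_eq_mul, mul_one] at this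
  have e : F 1 = 0 := by
    show Real.log (Φ' 1 p) = 0
    rw [h.log_one hp01, S.Lfix p hp]
  rw [e, mul_zero] at this
  exact this

lemma it_eq (h : S.Fl Φ Φ') (k : ℤ) (x : ℝ) : S.it k x = Φ k x := by
  induction k using Int.induction_on with
  | zero => simp [h.zero]
  | succ n ih => rw [it_succ, ih, ← h.one, ← h.add]; congr 1; push_cast; ring
  | pred n ih =>
    apply S.f.injective
    rw [← it_succ, ← h.one, ← h.add]
    push_cast at ih ⊢
    simpa using ih

lemma star (h : S.Fl Φ Φ') {a b : ℝ} (hc : S.Cmp a b) : S.Star a b := by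
  intro x hx y hy
  obtain ⟨h0, h1⟩ := hc.sub01 h.out
  have sub : Icc a b ⊆ Icc (0:ℝ) 1 := Icc_subset_Icc h0 h1
  have hx01 := sub (Ioo_subset_Icc_self hx)
  obtain ⟨s, -, hs⟩ : ∃ s ∈ uIcc (0:ℝ) 1, Φ s x = y := by
    have := intermediate_value_uIcc (a := 0) (b := 1) (h.tc hx01).continuousOn
    simp only [h.zero, h.one] at this
    exact this hy
  have hyc : y ∈ Ioo a b := ordConnected_Ioo.uIcc_subset hx (hc.f_mem hx) hy
  set κ : ℝ → ℝ := fun z => Real.log (Φ' s z) with hκ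
  have κc : ContinuousOn κ (Icc 0 1) := (h.dc s).log fun z hz => (h.pos s z hz).ne'
  have hdiff : ∀ z ∈ Icc (0:ℝ) 1, S.L (Φ s z) - S.L z = κ (S.f z) - κ z := fun z hz => by
    have e1 := h.coc 1 s hz
    have e2 := h.coc s 1 hz
    rw [add_comm] at e1
    rw [e1, h.log_one (h.maps s hz), h.log_one hz, h.one] at e2
    simp only [hκ]; linarith
  have hit : ∀ k : ℤ, S.it k y = Φ s (S.it k x) := fun k => by
    rw [h.it_eq, h.it_eq, ← hs, ← h.add, ← h.add, add_comm]
  have hmem : ∀ k : ℤ, S.it k x ∈ Icc (0:ℝ) 1 := fun k =>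
    sub (Ioo_subset_Icc_self (hc.it_mem k hx))
  have hterm : ∀ k : ℤ, S.L (S.it k y) - S.L (S.it k x) = κ (S.it (k+1) x) - κ (S.it k x) :=
    fun k => by rw [hit, hdiff _ (hmem k), it_succ]
  obtain ⟨s1, s2⟩ := hc.summable_L hx hyc
  obtain ⟨⟨p, hp, hpm, tp⟩, ⟨q, hq, hqm, tq⟩⟩ := hc.tendsto_it hx
  have lim : ∀ {r : ℝ} (u : ℕ → ℤ), S.f r = r → r ∈ Icc a b →
      Tendsto (fun n => S.it (u n) x) atTop (𝓝 r) →
      Tendsto (fun n => κ (S.it (u n) x)) atTop (𝓝 0) := fun {r} u hr hrm ht => by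
    have := κc r (sub hrm)
    have h2 : Tendsto (fun n => S.it (u n) x) atTop (𝓝[Icc 0 1] r) :=
      tendsto_nhdsWithin_iff.2 ⟨ht, Eventually.of_forall fun n => hmem _⟩
    have h3 := this.tendsto.comp h2
    rwa [show κ r = 0 from h.fixlog (sub hrm) hr s] at h3
  have t1 := lim (fun n => (n:ℤ)) hp hpm tp
  have t2 := lim (fun n => -(n:ℤ)) hq hqm tq
  have e1 : (∑' j : ℕ, (S.L (S.it j y) - S.L (S.it j x))) = 0 - κ x := by
    refine tendsto_nhds_unique s1.hasSum.tendsto_sum_nat ((t1.sub_const (κ x)).congr fun n => ?_)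
    have := Finset.sum_range_sub (fun j : ℕ => κ (S.it j x)) n
    simp only [Nat.cast_zero, it_zero] at this
    rw [← this]
    refine Finset.sum_congr rfl fun j _ => ?_
    rw [hterm]; push_cast; rfl
  have e2 : (∑' j : ℕ, (S.L (S.it (-(j + 1)) y) - S.L (S.it (-(j + 1)) x))) = κ x - 0 := by
    refine tendsto_nhds_unique s2.hasSum.tendsto_sum_nat ((t2.const_sub (κ x)).congr fun n => ?_)
    have := Finset.sum_range_sub' (fun j : ℕ => κ (S.it (-j) x)) n
    simp only [Nat.cast_zero, neg_zero, it_zero] at this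
    rw [← this]
    refine Finset.sum_congr rfl fun j _ => ?_
    rw [hterm, neg_add_rev, neg_add_cancel_comm]; push_cast; rw [neg_add_rev]
  rw [e1, e2]; ring

end Fl
end Su

namespace Su
variable {S : Su}

variable (S) in
def Bd (x y c : ℝ) : Prop := 0 ≤ c ∧ ∀ ε > (0:ℝ), ∀ᶠ n : ℕ in atTop,
  eVariationOn (S.g n) (Icc x y) ≤ ENNReal.ofReal (n * (c + ε))

lemma Bd.mono {x y c d : ℝ} (h : S.Bd x y c) (hcd : c ≤ d) : S.Bd x y d := by
  refine ⟨h.1.trans hcd, fun ε hε => ?_⟩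
  filter_upwards [h.2 ε hε] with n hn
  refine hn.trans (ENNReal.ofReal_le_ofReal ?_)
  gcongr

lemma Bd.add {x y z c d : ℝ} (h : S.Bd x y c) (h' : S.Bd y z d) (hxy : x ≤ y) (hyz : y ≤ z) :
    S.Bd x z (c + d) := by
  refine ⟨add_nonneg h.1 h'.1, fun ε hε => ?_⟩
  filter_upwards [h.2 (ε/2) (by positivity), h'.2 (ε/2) (by positivity)] with n h1 h2
  rw [evar_split _ hxy hyz]
  refine (add_le_add h1 h2).trans ?_
  have := h.1; have := h'.1
  rw [← ENNReal.ofReal_add (by positivity) (by positivity)]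
  refine ENNReal.ofReal_le_ofReal (le_of_eq ?_)
  ring

lemma bd_self (x : ℝ) : S.Bd x x 0 := by
  refine ⟨le_rfl, fun ε _ => Eventually.of_forall fun n => ?_⟩
  rw [eVariationOn.subsingleton _ (by simp)]
  exact bot_le

lemma bd_cmp (ho : S.Out) (hv : ∀ a b, S.Cmp a b → S.SmallVar a b) {x y : ℝ} (hxy : x ≤ y)
    (hn : ∀ z ∈ Ioo x y, S.f z ≠ z) : S.Bd x y 0 := by
  rcases hxy.eq_or_lt with rfl | hlt
  · exact bd_self x
  obtain ⟨z, hz⟩ : (Ioo x y).Nonempty := nonempty_Ioo.2 hlt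
  obtain ⟨a, b, hc, hm⟩ := ho.exists_cmp (hn z hz)
  have ha : a ≤ x := by
    by_contra hh; exact hn a ⟨not_le.1 hh, hm.1.trans hz.2⟩ hc.fa
  have hb : y ≤ b := by
    by_contra hh; exact hn b ⟨hz.1.trans hm.2, not_le.1 hh⟩ hc.fb
  refine ⟨le_rfl, fun ε hε => ?_⟩
  filter_upwards [hv a b hc ε hε] with n hn
  refine (eVariationOn.mono _ (Icc_subset_Icc ha hb)).trans (hn.trans (ENNReal.ofReal_le_ofReal ?_))
  linarith

lemma bd_fix {p q : ℝ} (hpq : p ≤ q) (hp : S.f p = p) (hq : S.f q = q) :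
    S.Bd p q (S.W q - S.W p) := by
  refine ⟨sub_nonneg.2 (S.Wm hpq), fun ε hε => Eventually.of_forall fun n => ?_⟩
  have hmaps : ∀ k : ℤ, MapsTo (S.it k) (Icc p q) (Icc p q) := fun k x hx => by
    constructor
    · simpa [S.it_fix hp] using (S.it_mono k).monotone hx.1
    · simpa [S.it_fix hq] using (S.it_mono k).monotone hx.2
  have h1 : eVariationOn (S.g n) (Icc p q) ≤
      ∑ j ∈ Finset.range n, eVariationOn (fun x => S.L (S.it j x)) (Icc p q) :=
    evar_sum (fun j x => S.L (S.it j x)) (Icc p q) n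
  refine h1.trans ((Finset.sum_le_sum (s := Finset.range n) fun (j : ℕ) _ =>
    (eVariationOn.comp_le_of_monotoneOn S.L (S.it j) ((S.it_mono j).monotone.monotoneOn _)
      (hmaps j)).trans (evar_L S hpq)).trans ?_)
  rw [Finset.sum_const, Finset.card_range, ← ENNReal.ofReal_nsmul, nsmul_eq_mul]
  refine ENNReal.ofReal_le_ofReal ?_
  gcongr; linarith

lemma bd_gen (ho : S.Out) (hv : ∀ a b, S.Cmp a b → S.SmallVar a b) {x y : ℝ} (hxy : x ≤ y) :
    S.Bd x y (S.W y - S.W x - |S.L y - S.L x|) := by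
  by_cases hp : ∃ p ∈ Icc x y, S.f p = p
  · obtain ⟨p, hpm, hpf, hpl⟩ := exists_first hp
    obtain ⟨q, hqm, hqf, hql⟩ := exists_last hp
    have hpq := hpl q hqm hqf
    have b1 := bd_cmp ho hv hpm.1 fun z hz hzf =>
      absurd (hpl z ⟨hz.1.le, hz.2.le.trans hpm.2⟩ hzf) (not_le.2 hz.2)
    have b2 := bd_cmp ho hv hqm.2 fun z hz hzf =>
      absurd (hql z ⟨hqm.1.trans hz.1.le, hz.2.le⟩ hzf) (not_le.2 hz.1)
    refine ((b1.add (bd_fix hpq hpf hqf) hpm.1 hpq).add b2 (hpm.1.trans hpq) hqm.2).mono ?_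
    have l1 := S.LW _ _ hpm.1
    have l2 := S.LW _ _ hqm.2
    rw [S.Lfix p hpf] at l1
    rw [S.Lfix q hqf] at l2
    have : |S.L y - S.L x| ≤ |S.L y - 0| + |0 - S.L x| := by
      refine le_trans (le_of_eq ?_) (abs_add_le _ _)
      congr 1; ring
    linarith
  · push Not at hp
    refine (bd_cmp ho hv hxy fun z hz => hp z (Ioo_subset_Icc_self hz)).mono ?_
    linarith [S.LW _ _ hxy]

lemma bd_part (ho : S.Out) (hv : ∀ a b, S.Cmp a b → S.SmallVar a b) {u : ℕ → ℝ} (hu : Monotone u)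
    (N : ℕ) : S.Bd (u 0) (u N)
      (S.W (u N) - S.W (u 0) - ∑ i ∈ Finset.range N, |S.L (u (i+1)) - S.L (u i)|) := by
  induction N with
  | zero => simpa using bd_self (S := S) (u 0)
  | succ N ih =>
    refine (ih.add (bd_gen ho hv (hu N.le_succ)) (hu N.zero_le) (hu N.le_succ)).mono (le_of_eq ?_)
    rw [Finset.sum_range_succ]; ring

lemma global_small (ho : S.Out) (hv : ∀ a b, S.Cmp a b → S.SmallVar a b)
    (hW : ENNReal.ofReal (S.W 1 - S.W 0) ≤ eVariationOn S.L (Icc 0 1)) : S.SmallVar 0 1 := by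
  have key : ∀ δ > (0:ℝ), S.Bd 0 1 δ := by
    intro δ hδ
    obtain ⟨⟨N, u, hu, us⟩, hlt⟩ : ∃ p : ℕ × { u : ℕ → ℝ // Monotone u ∧ ∀ i, u i ∈ Icc (0:ℝ) 1 },
        ENNReal.ofReal (S.W 1 - S.W 0) ≤ ENNReal.ofReal δ +
          ∑ i ∈ Finset.range p.1, edist (S.L ((p.2 : ℕ → ℝ) (i + 1))) (S.L ((p.2 : ℕ → ℝ) i)) := by
      by_contra hc
      push Not at hc
      by_cases hz : ENNReal.ofReal (S.W 1 - S.W 0) ≤ ENNReal.ofReal δ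
      · refine absurd (hc ⟨0, ⟨fun _ => 0, fun _ _ _ => le_rfl, fun _ => by simp⟩⟩) (not_lt.2 ?_)
        simpa using hz
      push Not at hz
      have : eVariationOn S.L (Icc 0 1) ≤ ENNReal.ofReal (S.W 1 - S.W 0) - ENNReal.ofReal δ :=
        iSup_le fun p => ENNReal.le_sub_of_add_le_left ENNReal.ofReal_ne_top (hc p).le
      have h2 := hW.trans this
      exact absurd h2 (not_le.2 (ENNReal.sub_lt_self ENNReal.ofReal_ne_top
        (ne_bot_of_gt hz) (by simpa using hδ)))
    have hsum : S.W 1 - S.W 0 ≤ δ + ∑ i ∈ Finset.range N, |S.L (u (i+1)) - S.L (u i)| := by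
      simp only [edist_dist, Real.dist_eq] at hlt
      rw [← ENNReal.ofReal_sum_of_nonneg (fun _ _ => abs_nonneg _),
        ← ENNReal.ofReal_add hδ.le (Finset.sum_nonneg fun _ _ => abs_nonneg _)] at hlt
      exact (ENNReal.ofReal_le_ofReal_iff
        (add_nonneg hδ.le (Finset.sum_nonneg fun _ _ => abs_nonneg _))).1 hlt
    have b1 := (bd_gen ho hv (us 0).1).mono
      (show _ ≤ S.W (u 0) - S.W 0 by linarith [abs_nonneg (S.L (u 0) - S.L 0)])
    have b2 := (bd_gen ho hv (us N).2).mono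
      (show _ ≤ S.W 1 - S.W (u N) by linarith [abs_nonneg (S.L 1 - S.L (u N))])
    refine ((b1.add (bd_part ho hv hu N) (us 0).1 (hu N.zero_le)).add b2 (us N).1 (us N).2).mono ?_
    linarith
  intro ε hε
  filter_upwards [(key (ε/2) (by positivity)).2 (ε/2) (by positivity)] with n hn
  refine hn.trans (ENNReal.ofReal_le_ofReal (le_of_eq ?_))
  ring

end Su


namespace C1bvDiffeo
variable (f : C1bvDiffeo)

lemma strictMonoOn' : StrictMonoOn f.toFun (Icc 0 1) := by
  refine strictMonoOn_of_hasDerivWithinAt_pos (f' := f.derivFun) (convex_Icc 0 1)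
    (fun x hx => (f.hasDeriv x hx).continuousWithinAt) (fun x hx => ?_) (fun x hx => ?_)
  · exact (f.hasDeriv x (interior_subset hx)).mono interior_subset
  · exact f.derivFun_pos x (interior_subset hx)

lemma iter_maps (n : ℕ) : MapsTo (f.toFun^[n]) (Icc 0 1) (Icc 0 1) := f.bijOn.mapsTo.iterate n

lemma iter_mono (n : ℕ) : MonotoneOn (f.toFun^[n]) (Icc 0 1) := by
  induction n with
  | zero => exact fun x _ y _ h => h
  | succ n ih =>
    intro x hx y hy hxy
    rw [Function.iterate_succ_apply', Function.iterate_succ_apply']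
    exact f.strictMonoOn'.monotoneOn (f.iter_maps n hx) (f.iter_maps n hy) (ih hx hy hxy)

lemma logDIter_add (m n : ℕ) (x : ℝ) :
    logDIter f (m + n) x = logDIter f m x + logDIter f n (f.toFun^[m] x) := by
  simp only [logDIter]
  rw [Finset.sum_range_add]
  congr 1
  refine Finset.sum_congr rfl fun j _ => ?_
  rw [← Function.iterate_add_apply, add_comm]

lemma var_fin (n : ℕ) : eVariationOn (logDIter f n) (Icc 0 1) ≠ ⊤ := by
  have h1 : eVariationOn (logDIter f n) (Icc 0 1) ≤
      ∑ j ∈ Finset.range n, eVariationOn (fun x => Real.log (f.derivFun (f.toFun^[j] x))) (Icc 0 1) :=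
    Su.evar_sum (fun j x => Real.log (f.derivFun (f.toFun^[j] x))) (Icc 0 1) n
  refine ne_top_of_le_ne_top ?_ h1
  refine ENNReal.sum_ne_top.2 fun j _ => ne_top_of_le_ne_top f.logDeriv_bv ?_
  exact eVariationOn.comp_le_of_monotoneOn (fun x => Real.log (f.derivFun x)) _ (f.iter_mono j)
    (f.iter_maps j)

lemma subadd : Subadditive (varLogDIter f) := by
  intro m n
  simp only [varLogDIter]
  rw [← ENNReal.toReal_add (f.var_fin m) (f.var_fin n)]
  refine ENNReal.toReal_mono (ENNReal.add_ne_top.2 ⟨f.var_fin m, f.var_fin n⟩) ?_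
  have e : logDIter f (m + n) = fun x => logDIter f m x + logDIter f n (f.toFun^[m] x) :=
    funext fun x => f.logDIter_add m n x
  rw [e]
  refine (Su.evar_add _ _ _).trans (add_le_add_right ?_ _)
  exact eVariationOn.comp_le_of_monotoneOn (logDIter f n) _ (f.iter_mono m) (f.iter_maps m)

lemma iter_deriv (n : ℕ) {x : ℝ} (hx : x ∈ Icc (0:ℝ) 1) :
    HasDerivWithinAt (f.toFun^[n]) (Real.exp (logDIter f n x)) (Icc 0 1) x := by
  induction n with
  | zero => simpa [logDIter] using hasDerivWithinAt_id x (Icc (0:ℝ) 1)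
  | succ n ih =>
    have h1 := (f.hasDeriv _ (f.iter_maps n hx)).comp x ih (f.iter_maps n)
    rw [← Function.iterate_succ'] at h1
    have e : logDIter f (n + 1) x =
        logDIter f n x + Real.log (f.derivFun (f.toFun^[n] x)) := Finset.sum_range_succ _ n
    rw [e, Real.exp_add, Real.exp_log (f.derivFun_pos _ (f.iter_maps n hx)), mul_comm]
    exact h1

lemma exists_zero (n : ℕ) : ∃ c ∈ Icc (0:ℝ) 1, logDIter f n c = 0 := by
  obtain ⟨c, hc, he⟩ := exists_hasDerivAt_eq_slope (f.toFun^[n])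
    (fun x => Real.exp (logDIter f n x)) (zero_lt_one : (0:ℝ) < 1)
    (fun x hx => (f.iter_deriv n hx).continuousWithinAt)
    (fun x hx => (f.iter_deriv n (Ioo_subset_Icc_self hx)).hasDerivAt (Icc_mem_nhds hx.1 hx.2))
  refine ⟨c, Ioo_subset_Icc_self hc, ?_⟩
  rw [Function.iterate_fixed f.map_zero, Function.iterate_fixed f.map_one] at he
  simpa using he

lemma parabolic (h : Tendsto (fun n : ℕ => varLogDIter f n / n) atTop (𝓝 0)) {p : ℝ}
    (hp : p ∈ Icc (0:ℝ) 1) (hpf : f.toFun p = p) : f.derivFun p = 1 := by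
  have hb : ∀ᶠ n : ℕ in atTop, |Real.log (f.derivFun p)| ≤ varLogDIter f n / n := by
    filter_upwards [eventually_gt_atTop 0] with n hn
    obtain ⟨c, hc, h0⟩ := f.exists_zero n
    have h1 := eVariationOn.edist_le (logDIter f n) hp hc
    have h2 : logDIter f n p = n * Real.log (f.derivFun p) := by
      simp [logDIter, Function.iterate_fixed hpf]
    have h3 := ENNReal.toReal_mono (f.var_fin n) h1
    rw [edist_dist, ENNReal.toReal_ofReal dist_nonneg, Real.dist_eq, h0, h2, sub_zero, abs_mul,
      Nat.abs_cast] at h3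
    rw [le_div_iff₀ (by exact_mod_cast hn), mul_comm]
    exact h3
  have h0 := ge_of_tendsto h hb
  have h1 : Real.log (f.derivFun p) = 0 := abs_eq_zero.1 (le_antisymm h0 (abs_nonneg _))
  exact Real.eq_one_of_pos_of_log_eq_zero (f.derivFun_pos p hp) h1

lemma strictMono' : StrictMono f.toFun := by
  intro x y hxy
  have hin : ∀ z ∈ Icc (0:ℝ) 1, f.toFun z ∈ Icc (0:ℝ) 1 := f.bijOn.mapsTo
  by_cases hx : x ∈ Icc (0:ℝ) 1 <;> by_cases hy : y ∈ Icc (0:ℝ) 1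
  · exact f.strictMonoOn' hx hy hxy
  · rw [f.fixes_outside y hy]
    have : 1 < y := by
      by_contra hc; exact hy ⟨hx.1.trans hxy.le, not_lt.1 hc⟩
    exact (hin x hx).2.trans_lt this
  · rw [f.fixes_outside x hx]
    have : x < 0 := by
      by_contra hc; exact hx ⟨not_lt.1 hc, hxy.le.trans hy.2⟩
    exact this.trans_le (hin y hy).1
  · rwa [f.fixes_outside x hx, f.fixes_outside y hy]

lemma surj' : Function.Surjective f.toFun := by
  intro y
  by_cases hy : y ∈ Icc (0:ℝ) 1
  · obtain ⟨x, -, hx⟩ := f.bijOn.surjOn hy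
    exact ⟨x, hx⟩
  · exact ⟨y, f.fixes_outside y hy⟩

def oi : ℝ ≃o ℝ := StrictMono.orderIsoOfSurjective f.toFun f.strictMono' f.surj'

def pr (x : ℝ) : ℝ := max 0 (min 1 x)
lemma pr_mem (x : ℝ) : pr x ∈ Icc (0:ℝ) 1 := ⟨le_max_left _ _, max_le zero_le_one (min_le_left _ _)⟩
lemma pr_mono : Monotone pr := fun x y h => max_le_max le_rfl (min_le_min le_rfl h)
lemma pr_cont : Continuous pr := by unfold pr; fun_prop
lemma pr_of_mem {x : ℝ} (hx : x ∈ Icc (0:ℝ) 1) : pr x = x := by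
  simp [pr, hx.1, hx.2]
lemma pr_of_le {x : ℝ} (hx : x ≤ 0) : pr x = 0 := by
  simp [pr, hx.trans zero_le_one, hx]
lemma pr_of_ge {x : ℝ} (hx : 1 ≤ x) : pr x = 1 := by
  simp [pr, hx]

def LL (x : ℝ) : ℝ := Real.log (f.derivFun (pr x))

lemma LL_cont : Continuous f.LL :=
  (f.derivFun_cont.comp_continuous pr_cont pr_mem).log fun x => (f.derivFun_pos _ (pr_mem x)).ne'

lemma LL_bv : BoundedVariationOn f.LL univ := by
  refine ne_top_of_le_ne_top f.logDeriv_bv ?_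
  exact eVariationOn.comp_le_of_monotoneOn (fun x => Real.log (f.derivFun x)) pr
    (pr_mono.monotoneOn _) (fun x _ => pr_mem x)

def WW (x : ℝ) : ℝ := variationOnFromTo f.LL univ 0 x

lemma WW_sub (x y : ℝ) : f.WW y = f.WW x + ((eVariationOn f.LL (univ ∩ Icc x y)).toReal -
    (eVariationOn f.LL (univ ∩ Icc y x)).toReal) := by
  have h := variationOnFromTo.add f.LL_bv.locallyBoundedVariationOn (mem_univ 0) (mem_univ x) (mem_univ y)
  have h0 : ∀ u v : ℝ, u ≤ v → (eVariationOn f.LL (univ ∩ Icc v u)).toReal = 0 := fun u v huv => by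
    rw [eVariationOn.subsingleton]
    · simp
    · rw [univ_inter]
      exact subsingleton_Icc_of_ge huv
  simp only [WW]
  rw [← h]
  congr 1
  rcases le_total x y with hxy | hxy
  · rw [variationOnFromTo.eq_of_le _ _ hxy, h0 x y hxy, sub_zero]
  · rw [variationOnFromTo.eq_of_ge _ _ hxy, h0 y x hxy, zero_sub]

lemma WW_cont : Continuous f.WW := by
  rw [continuous_iff_continuousAt]
  intro x
  have h1 := f.LL_bv.tendsto_eVariationOn_Icc_zero_right x f.LL_cont.continuousWithinAt
  have h2 := f.LL_bv.tendsto_eVariationOn_Icc_zero_left (x := x) f.LL_cont.continuousWithinAt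
  rw [nhdsWithin_univ] at h1 h2
  have h3 := (ENNReal.tendsto_toReal ENNReal.zero_ne_top).comp h1
  have h4 := (ENNReal.tendsto_toReal ENNReal.zero_ne_top).comp h2
  have h5 := (h3.sub h4).const_add (f.WW x)
  simp only [sub_self, add_zero, ENNReal.toReal_zero] at h5
  exact h5.congr fun y => (f.WW_sub x y).symm

def su (hpar : ∀ p ∈ Icc (0:ℝ) 1, f.toFun p = p → f.derivFun p = 1) : Su where
  f := f.oi
  L := f.LL
  W := f.WW
  hd := by
    intro x
    show HasDerivAt f.toFun (Real.exp (f.LL x)) x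
    have hd0 : f.derivFun 0 = 1 := hpar 0 (by simp) f.map_zero
    have hd1 : f.derivFun 1 = 1 := hpar 1 (by simp) f.map_one
    have idl : ∀ z ≤ (0:ℝ), f.toFun z = z := fun z hz => by
      rcases hz.eq_or_lt with rfl | hz
      · exact f.map_zero
      · exact f.fixes_outside z fun h => absurd h.1 (not_le.2 hz)
    have idr : ∀ z ≥ (1:ℝ), f.toFun z = z := fun z hz => by
      rcases (show (1:ℝ) ≤ z from hz).eq_or_lt with rfl | hz
      · exact f.map_one
      · exact f.fixes_outside z fun h => absurd h.2 (not_le.2 hz)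
    rcases lt_trichotomy x 0 with hx | rfl | hx
    · rw [LL, pr_of_le hx.le, hd0, Real.log_one, Real.exp_zero]
      refine (hasDerivAt_id x).congr_of_eventuallyEq ?_
      filter_upwards [Iio_mem_nhds hx] with z hz using idl z (le_of_lt hz)
    · rw [LL, pr_of_le le_rfl, hd0, Real.log_one, Real.exp_zero]
      have h1 : HasDerivWithinAt f.toFun 1 (Ici 0) 0 := by
        have := f.hasDeriv 0 (by simp)
        rw [hd0] at this
        exact this.mono_of_mem_nhdsWithin (Icc_mem_nhdsGE zero_lt_one)
      have h2 : HasDerivWithinAt f.toFun 1 (Iic 0) 0 :=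
        (hasDerivWithinAt_id (0:ℝ) (Iic 0)).congr (fun z hz => idl z hz) f.map_zero
      have := h2.union h1
      rwa [Iic_union_Ici, hasDerivWithinAt_univ] at this
    rcases lt_trichotomy x 1 with hx1 | rfl | hx1
    · rw [LL, pr_of_mem ⟨hx.le, hx1.le⟩, Real.exp_log (f.derivFun_pos x ⟨hx.le, hx1.le⟩)]
      exact (f.hasDeriv x ⟨hx.le, hx1.le⟩).hasDerivAt (Icc_mem_nhds hx hx1)
    · rw [LL, pr_of_ge le_rfl, hd1, Real.log_one, Real.exp_zero]
      have h1 : HasDerivWithinAt f.toFun 1 (Iic 1) 1 := by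
        have := f.hasDeriv 1 (by simp)
        rw [hd1] at this
        exact this.mono_of_mem_nhdsWithin (Icc_mem_nhdsLE zero_lt_one)
      have h2 : HasDerivWithinAt f.toFun 1 (Ici 1) 1 :=
        (hasDerivWithinAt_id (1:ℝ) (Ici 1)).congr (fun z hz => idr z hz) f.map_one
      have := h1.union h2
      rwa [Iic_union_Ici, hasDerivWithinAt_univ] at this
    · rw [LL, pr_of_ge hx1.le, hd1, Real.log_one, Real.exp_zero]
      refine (hasDerivAt_id x).congr_of_eventuallyEq ?_
      filter_upwards [Ioi_mem_nhds hx1] with z hz using idr z (le_of_lt hz)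
  Lc := f.LL_cont
  Wc := f.WW_cont
  Wm := fun x y hxy => variationOnFromTo.monotoneOn f.LL_bv.locallyBoundedVariationOn (mem_univ 0)
    (mem_univ x) (mem_univ y) hxy
  LW := fun x y hxy => by
    have h := eVariationOn.edist_le f.LL (s := univ ∩ Icc x y) (x := y) (y := x)
      ⟨trivial, right_mem_Icc.2 hxy⟩ ⟨trivial, left_mem_Icc.2 hxy⟩
    have hfin : eVariationOn f.LL (univ ∩ Icc x y) ≠ ⊤ :=
      ne_top_of_le_ne_top f.LL_bv (eVariationOn.mono _ (subset_univ _))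
    have h1 := ENNReal.toReal_mono hfin h
    rw [edist_dist, ENNReal.toReal_ofReal dist_nonneg, Real.dist_eq] at h1
    have h2 := f.WW_sub x y
    have h3 : (eVariationOn f.LL (univ ∩ Icc y x)).toReal = 0 := by
      rw [eVariationOn.subsingleton]
      · simp
      · rw [univ_inter]; exact subsingleton_Icc_of_ge hxy
    linarith
  Lfix := fun x hx => by
    have hx' : f.toFun x = x := hx
    have hd0 : f.derivFun 0 = 1 := hpar 0 (by simp) f.map_zero
    have hd1 : f.derivFun 1 = 1 := hpar 1 (by simp) f.map_one
    rw [LL]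
    rcases le_total x 0 with h0 | h0
    · rw [pr_of_le h0, hd0, Real.log_one]
    rcases le_total x 1 with h1 | h1
    · rw [pr_of_mem ⟨h0, h1⟩, hpar x ⟨h0, h1⟩ hx', Real.log_one]
    · rw [pr_of_ge h1, hd1, Real.log_one]

section
variable {f} {hpar : ∀ p ∈ Icc (0:ℝ) 1, f.toFun p = p → f.derivFun p = 1}

lemma su_f (x : ℝ) : (f.su hpar).f x = f.toFun x := rfl

lemma su_out : (f.su hpar).Out := by
  intro x hx
  rw [su_f]
  by_cases h : x ∈ Icc (0:ℝ) 1
  · rcases h.1.eq_or_lt with h0 | h0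
    · rw [← h0, f.map_zero]
    rcases h.2.eq_or_lt with h1 | h1
    · rw [h1, f.map_one]
    · exact absurd ⟨h0, h1⟩ hx
  · exact f.fixes_outside x h

lemma su_W : ENNReal.ofReal ((f.su hpar).W 1 - (f.su hpar).W 0) ≤
    eVariationOn (f.su hpar).L (Icc 0 1) := by
  show ENNReal.ofReal (f.WW 1 - f.WW 0) ≤ eVariationOn f.LL (Icc 0 1)
  have h := f.WW_sub 0 1
  have h2 : f.WW 1 - f.WW 0 ≤ (eVariationOn f.LL (univ ∩ Icc 0 1)).toReal := by
    have : 0 ≤ (eVariationOn f.LL (univ ∩ Icc 1 0)).toReal := ENNReal.toReal_nonneg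
    linarith
  refine (ENNReal.ofReal_le_ofReal h2).trans ?_
  rw [univ_inter]
  exact ENNReal.ofReal_toReal_le

lemma su_var (n : ℕ) : eVariationOn ((f.su hpar).g n) (Icc 0 1) =
    eVariationOn (logDIter f n) (Icc 0 1) := by
  refine eVariationOn.eq_of_eqOn fun x hx => ?_
  simp only [Su.g, logDIter]
  refine Finset.sum_congr rfl fun j _ => ?_
  rw [← Su.iterate_eq]
  show Real.log (f.derivFun (pr (f.toFun^[j] x))) = _
  rw [pr_of_mem (f.iter_maps j hx)]

lemma small_iff : (f.su hpar).SmallVar 0 1 ↔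
    Tendsto (fun n : ℕ => varLogDIter f n / n) atTop (𝓝 0) := by
  constructor
  · intro h
    rw [Metric.tendsto_atTop']
    intro ε hε
    obtain ⟨N, hN⟩ := eventually_atTop.1 ((h (ε/2) (by positivity)).and (eventually_gt_atTop 0))
    refine ⟨N, fun n hn => ?_⟩
    obtain ⟨h1, h2⟩ := hN n hn.le
    rw [su_var] at h1
    have h3 := ENNReal.toReal_mono ENNReal.ofReal_ne_top h1
    rw [ENNReal.toReal_ofReal (by positivity)] at h3
    have hn0 : (0:ℝ) < n := by exact_mod_cast h2
    have hv0 : 0 ≤ varLogDIter f n := ENNReal.toReal_nonneg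
    rw [Real.dist_eq, sub_zero, abs_of_nonneg (div_nonneg hv0 hn0.le),
      div_lt_iff₀ hn0]
    refine lt_of_le_of_lt h3 ?_
    nlinarith
  · intro h ε hε
    filter_upwards [h.eventually (gt_mem_nhds hε), eventually_gt_atTop 0] with n h1 h2
    have hn0 : (0:ℝ) < n := by exact_mod_cast h2
    rw [div_lt_iff₀ hn0] at h1
    rw [su_var, ← ENNReal.ofReal_toReal (f.var_fin n)]
    exact ENNReal.ofReal_le_ofReal h1.le

end
end C1bvDiffeo


/-- For a `C^{1+bv}` diffeomorphism `f` of `[0,1]`, the asymptotic variation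
`V_∞(f) = lim var(log Dfⁿ)/n` exists, and it vanishes if and only if `f` embeds into a `C¹`
flow on `[0,1]` and has no hyperbolic fixed point. -/
theorem asymptotic_variation_zero_iff_flowable_without_hyperbolic_fixed_point
    (f : C1bvDiffeo) :
    ∃ V : ℝ, Tendsto (fun n : ℕ => varLogDIter f n / n) atTop (𝓝 V) ∧
      (V = 0 ↔
        ((∃ Φ Φ' : ℝ → ℝ → ℝ, IsC1FlowOn (Icc (0:ℝ) 1) Φ Φ' ∧
            ∀ x : ℝ, Φ 1 x = f.toFun x) ∧
         (∀ p ∈ Icc (0:ℝ) 1, f.toFun p = p → f.derivFun p = 1))) := by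
  have hbdd : BddBelow (range fun n : ℕ => varLogDIter f n / n) := ⟨0, by
    rintro _ ⟨n, rfl⟩
    exact div_nonneg ENNReal.toReal_nonneg (Nat.cast_nonneg n)⟩
  have hlim := f.subadd.tendsto_lim hbdd
  refine ⟨f.subadd.lim, hlim, ?_⟩
  constructor
  · intro h0
    rw [h0] at hlim
    have hpar : ∀ p ∈ Icc (0:ℝ) 1, f.toFun p = p → f.derivFun p = 1 :=
      fun p hp hpf => f.parabolic hlim hp hpf
    refine ⟨?_, hpar⟩
    have hs := (C1bvDiffeo.small_iff (hpar := hpar)).2 hlim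
    have ho := C1bvDiffeo.su_out (hpar := hpar)
    obtain ⟨Φ, Ψ, hG⟩ := ho.exists_GF fun a b hab ε hε => by
      obtain ⟨h1, h2⟩ := hab.sub01 ho
      filter_upwards [hs ε hε] with n hn
      exact (eVariationOn.mono _ (Icc_subset_Icc h1 h2)).trans hn
    have f0 : (f.su hpar).f 0 = 0 := ho 0 (by simp)
    have f1 : (f.su hpar).f 1 = 1 := ho 1 (by simp)
    have hmaps : ∀ t, MapsTo (Φ t) (Icc (0:ℝ) 1) (Icc 0 1) := fun t x hx =>
      ⟨hG.ge_fix t f0 hx.1, hG.le_fix t f1 hx.2⟩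
    refine ⟨Φ, fun t x => Real.exp (Ψ t x), ⟨hG.zero, hG.add, ?_, ?_, ?_, ?_, ?_, ?_⟩, hG.one⟩
    · exact fun t x hx => hG.fix t x (ho x fun h => hx (Ioo_subset_Icc_self h))
    · exact fun t => ⟨hmaps t, (hG.bij t).1.injOn, fun y hy =>
        ⟨Φ (-t) y, hmaps _ hy, hG.neg_cancel t y⟩⟩
    · exact fun t x _ => (hG.hd t x).hasDerivWithinAt
    · exact fun t => (hG.psi_cont t).rexp.continuousOn
    · exact fun t x _ => Real.exp_pos _
    · intro t₀ K hK _ ε hε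
      simp only [Real.log_exp]
      exact hG.c1 t₀ hK hε
  · rintro ⟨⟨Φ, Φ', ⟨h1, h2, h3, h4, h5, h6, h7, h8⟩, h9⟩, hpar⟩
    have ho := C1bvDiffeo.su_out (hpar := hpar)
    have hF : (f.su hpar).Fl Φ Φ' :=
      { out := ho
        zero := h1
        add := h2
        maps := fun t => (h4 t).mapsTo
        hd := h5
        dc := h6
        pos := h7
        c1 := fun t₀ => h8 t₀ (Icc 0 1) isCompact_Icc subset_rfl
        one := h9 }
    have hs := Su.global_small ho (fun a b hab => hab.smallVar_of_star (hF.star hab))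
      C1bvDiffeo.su_W
    exact tendsto_nhds_unique hlim (C1bvDiffeo.small_iff.1 hs)
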